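/- arXiv:2603.21021 — 5 statements merged into one kernel-verified Lean document; each statement's English description precedes it below -/
import Mathlib

section
/- Let m and n be positive integers with m even, let A and B be m×n matrices and X an n×n matrix over a commutative ring, and let J denote the n×n all-ones matrix. Then det(A·X·Bᵗ + B·(J − Xᵗ)·Aᵗ) = f_{A,B}(X) · f_{B,A}(J − Xᵗ). -/
open Matrix

/-- Strictly increasing functions `Fin k → Fin n`; these encode the `k`-element
subsets of `{1,…,n}` listed in increasing order. -/
def incrFuns (k n : ℕ) : Finset (Fin k → Fin n) :=
  Finset.univ.filter fun f => ∀ a b : Fin k, a < b → f a < f b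

/-- The `2k × 2k` matrix `(Aᴵ Bᴶ)` obtained by concatenating the columns of `A`
indexed by `fI` with the columns of `B` indexed by `fJ`. -/
def concatCB {R : Type*} [CommRing R] {k n : ℕ} (A B : Matrix (Fin (2*k)) (Fin n) R)
    (fI fJ : Fin k → Fin n) : Matrix (Fin (2*k)) (Fin (2*k)) R :=
  Matrix.of fun i j =>
    if h : (j:ℕ) < k then A i (fI ⟨j, h⟩) else B i (fJ ⟨(j:ℕ) - k, by have := j.isLt; omega⟩)

/-- `f_{A,B}(X) = Σ_{I,J⊆[n], |I|=|J|=m/2} det(X_{I,J}) · det(Aᴵ Bᴶ)`. -/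
def fAB {R : Type*} [CommRing R] {k n : ℕ} (A B : Matrix (Fin (2*k)) (Fin n) R)
    (X : Matrix (Fin n) (Fin n) R) : R :=
  ∑ fI ∈ incrFuns k n, ∑ fJ ∈ incrFuns k n,
    (X.submatrix fI fJ).det * (concatCB A B fI fJ).det

/-- The all-ones matrix `𝒥`. -/
def allOnes (R : Type*) [CommRing R] (n : ℕ) : Matrix (Fin n) (Fin n) R :=
  Matrix.of fun _ _ => 1

section Helpers
open Equiv Finset

lemma aux_sum_incr {R : Type*} [CommRing R] {k n : ℕ} (F : (Fin k → Fin n) → R)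
    (hperm : ∀ f (τ : Perm (Fin k)), F (f ∘ τ) = F f)
    (hinj : ∀ f, ¬ Function.Injective f → F f = 0) :
    ∑ f, F f = (k.factorial : R) * ∑ f ∈ incrFuns k n, F f := by
  classical
  have hmono : ∀ f, f ∈ incrFuns k n ↔ StrictMono f := by
    intro f
    simp only [incrFuns, mem_filter, mem_univ, true_and]
    exact ⟨fun h a b => h a b, fun h a b => @h a b⟩
  have h1 : ∑ f, F f = ∑ p ∈ (incrFuns k n) ×ˢ (univ : Finset (Perm (Fin k))), F (p.1 ∘ p.2) := by
    symm
    have h2 : ∑ f, F f = ∑ f ∈ univ.filter (fun f : Fin k → Fin n => Function.Injective f), F f := by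
      symm
      apply sum_subset (subset_univ _)
      intro f _ hf
      apply hinj
      simpa using hf
    rw [h2]
    apply sum_nbij (fun p => p.1 ∘ p.2)
    · rintro ⟨g, τ⟩ h
      simp only [mem_product, mem_univ, and_true, hmono] at h
      simp only [mem_filter, mem_univ, true_and]
      exact h.injective.comp τ.injective
    · rintro ⟨g, τ⟩ h ⟨g', τ'⟩ h' heq
      simp only [coe_product, Set.mem_prod, mem_coe, hmono] at h h'
      simp only at heq
      have hg : g = g' := by
        rw [← h.1.range_inj h'.1]
        have := congrArg Set.range heq
        rwa [τ.surjective.range_comp, τ'.surjective.range_comp] at this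
      subst hg
      simp only [Prod.mk.injEq, true_and]
      ext i
      have := h.1.injective (congrFun heq i)
      rw [this]
    · intro f hf
      simp only [coe_filter, mem_univ, true_and, Set.mem_setOf_eq] at hf
      refine ⟨(f ∘ Tuple.sort f, (Tuple.sort f)⁻¹), ?_, ?_⟩
      · simp only [coe_product, Set.mem_prod, mem_coe, hmono, mem_univ, and_true]
        exact (Tuple.monotone_sort f).strictMono_of_injective
          (hf.comp (Tuple.sort f).injective)
      · ext i; simp
    · intros; rfl
  rw [h1, sum_product, mul_sum]
  apply sum_congr rfl
  intro g _
  simp [hperm, Fintype.card_perm]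

/-- the Pfaffian-like sum -/
def auxH {R : Type*} [CommRing R] {k : ℕ} (M : Matrix (Fin k ⊕ Fin k) (Fin k ⊕ Fin k) R) : R :=
  ∑ σ : Perm (Fin k ⊕ Fin k), ((Perm.sign σ : ℤ) : R) * ∏ i, M (σ (Sum.inl i)) (σ (Sum.inr i))

/-- concatenation with sum indices -/
def auxD {R : Type*} [CommRing R] {k n : ℕ} (A B : Matrix (Fin k ⊕ Fin k) (Fin n) R)
    (f g : Fin k → Fin n) : R :=
  (fromCols (A.submatrix id f) (B.submatrix id g)).det

lemma auxD_left {R : Type*} [CommRing R] {k n : ℕ} (A B : Matrix (Fin k ⊕ Fin k) (Fin n) R)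
    (f g : Fin k → Fin n) (τ : Perm (Fin k)) :
    auxD A B (f ∘ τ) g = ((Perm.sign τ : ℤ) : R) * auxD A B f g := by
  unfold auxD
  have := det_permute' (Equiv.sumCongr τ (1 : Perm (Fin k)))
    (fromCols (A.submatrix id f) (B.submatrix id g))
  rw [show Perm.sign (Equiv.sumCongr τ (1 : Perm (Fin k))) = Perm.sign τ by
    simpa using Perm.sign_sumCongr τ (1 : Perm (Fin k))] at this
  rw [← this]
  congr 1
  ext i (j | j) <;> simp

lemma auxD_right {R : Type*} [CommRing R] {k n : ℕ} (A B : Matrix (Fin k ⊕ Fin k) (Fin n) R)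
    (f g : Fin k → Fin n) (τ : Perm (Fin k)) :
    auxD A B f (g ∘ τ) = ((Perm.sign τ : ℤ) : R) * auxD A B f g := by
  unfold auxD
  have := det_permute' (Equiv.sumCongr (1 : Perm (Fin k)) τ)
    (fromCols (A.submatrix id f) (B.submatrix id g))
  rw [show Perm.sign (Equiv.sumCongr (1 : Perm (Fin k)) τ) = Perm.sign τ by
    simpa using Perm.sign_sumCongr (1 : Perm (Fin k)) τ] at this
  rw [← this]
  congr 1
  ext i (j | j) <;> simp

lemma auxSign {R : Type*} [CommRing R] {α : Type*} [DecidableEq α] [Fintype α] (τ : Perm α) :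
    ((Perm.sign τ : ℤ) : R) * ((Perm.sign τ : ℤ) : R) = 1 := by
  rcases Int.units_eq_one_or (Perm.sign τ) with h | h <;> simp [h]

/-- sum-indexed version of fAB -/
def auxF {R : Type*} [CommRing R] {k n : ℕ} (A B : Matrix (Fin k ⊕ Fin k) (Fin n) R)
    (X : Matrix (Fin n) (Fin n) R) : R :=
  ∑ fI ∈ incrFuns k n, ∑ fJ ∈ incrFuns k n, (X.submatrix fI fJ).det * auxD A B fI fJ

lemma auxH_expand {R : Type*} [CommRing R] {k n : ℕ} (A B : Matrix (Fin k ⊕ Fin k) (Fin n) R)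
    (X : Matrix (Fin n) (Fin n) R) :
    auxH (A * X * Bᵀ) = ∑ f : Fin k → Fin n, ∑ g : Fin k → Fin n,
      (∏ i, X (f i) (g i)) * auxD A B f g := by
  have h1 : ∀ r s, (A * X * Bᵀ) r s = ∑ p, A r p * ∑ q, X p q * B s q := by
    intro r s
    rw [Matrix.mul_assoc]
    simp [Matrix.mul_apply]
  unfold auxH
  simp_rw [h1, prod_univ_sum, Fintype.piFinset_univ, prod_mul_distrib, prod_univ_sum,
    Fintype.piFinset_univ, prod_mul_distrib, mul_sum]
  rw [sum_comm]
  apply sum_congr rfl; intro f _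
  rw [sum_comm]
  apply sum_congr rfl; intro g _
  unfold auxD
  rw [det_apply', mul_sum]
  apply sum_congr rfl; intro σ _
  simp only [Fintype.prod_sum_type, fromCols_apply_inl, fromCols_apply_inr, submatrix_apply, id]
  ring

lemma auxF_eq {R : Type*} [CommRing R] {k n : ℕ} (A B : Matrix (Fin k ⊕ Fin k) (Fin n) R)
    (X : Matrix (Fin n) (Fin n) R) :
    (k.factorial : R) * ((k.factorial : R) * auxF A B X) = (k.factorial : R) * auxH (A * X * Bᵀ) := by
  have hz : ∀ (f : Fin k → Fin n), ¬ Function.Injective f → ∃ i j, f i = f j ∧ i ≠ j := by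
    intro f hf
    simpa [Function.Injective] using hf
  have h1 : (k.factorial : R) * ((k.factorial : R) * auxF A B X) =
      ∑ f : Fin k → Fin n, ∑ g : Fin k → Fin n, (X.submatrix f g).det * auxD A B f g := by
    unfold auxF
    rw [aux_sum_incr (fun f => ∑ g : Fin k → Fin n, (X.submatrix f g).det * auxD A B f g)]
    · congr 1
      rw [mul_sum]
      apply sum_congr rfl; intro f _
      rw [aux_sum_incr]
      · intro g τ
        rw [auxD_right]
        have := det_permute' τ (X.submatrix f g)
        rw [submatrix_submatrix] at this
        simp only [Function.comp_id] at this
        rw [this]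
        linear_combination (X.submatrix f g).det * auxD A B f g * auxSign (R := R) τ
      · intro g hg
        obtain ⟨i, j, hij, hne⟩ := hz g hg
        rw [det_zero_of_column_eq hne (by simp [hij]), zero_mul]
    · intro f τ
      apply sum_congr rfl; intro g _
      rw [auxD_left]
      have := det_permute τ (X.submatrix f g)
      rw [submatrix_submatrix] at this
      simp only [Function.comp_id] at this
      rw [this]
      linear_combination (X.submatrix f g).det * auxD A B f g * auxSign (R := R) τ
    · intro f hf
      obtain ⟨i, j, hij, hne⟩ := hz f hf
      apply sum_eq_zero; intro g _
      rw [det_zero_of_row_eq hne (by ext; simp [hij]), zero_mul]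
  rw [h1, auxH_expand]
  simp_rw [det_apply', sum_mul]
  have h2 : ∀ f : Fin k → Fin n, ∑ g : Fin k → Fin n, ∑ τ : Perm (Fin k),
      ((Perm.sign τ : ℤ) : R) * (∏ i, X.submatrix f g (τ i) i) * auxD A B f g =
      ∑ τ : Perm (Fin k), ∑ g : Fin k → Fin n,
      ((Perm.sign τ : ℤ) : R) * (∏ i, X.submatrix f g (τ i) i) * auxD A B f g :=
    fun f => sum_comm
  simp_rw [h2]
  rw [sum_comm]
  have h3 : ∀ τ : Perm (Fin k), ∑ f : Fin k → Fin n, ∑ g : Fin k → Fin n,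
      ((Perm.sign τ : ℤ) : R) * (∏ i, X.submatrix f g (τ i) i) * auxD A B f g =
      ∑ f : Fin k → Fin n, ∑ g : Fin k → Fin n, (∏ i, X (f i) (g i)) * auxD A B f g := by
    intro τ
    rw [← Equiv.sum_comp (Equiv.arrowCongr τ (Equiv.refl (Fin n)))]
    apply sum_congr rfl; intro f _
    apply sum_congr rfl; intro g _
    have : (Equiv.arrowCongr τ (Equiv.refl (Fin n))) f = f ∘ (τ⁻¹ : Perm (Fin k)) := by
      ext i; rfl
    have hinv : ∀ i, (τ⁻¹ : Perm (Fin k)) (τ i) = i := fun i => τ.symm_apply_apply i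
    rw [this, auxD_left]
    simp only [submatrix_apply, Function.comp, hinv, Perm.sign_inv]
    linear_combination (∏ i, X (f i) (g i)) * auxD A B f g * auxSign (R := R) τ
  simp_rw [h3]
  simp [Fintype.card_perm]

/-- vanishing under a sign reversing symmetry -/
lemma aux_vanish {R : Type*} [CommRing R] {α : Type*} [DecidableEq α] [Fintype α]
    (Φ : Perm α → R) (x y : α) (hxy : x ≠ y) (h : ∀ σ, Φ (σ * swap x y) = Φ σ) :
    ∑ σ : Perm α, ((Perm.sign σ : ℤ) : R) * Φ σ = 0 := by
  apply sum_involution (fun σ _ => σ * swap x y)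
  · intro σ _
    rw [h]
    simp [Perm.sign_mul, Perm.sign_swap hxy]
  · intro σ _ _ he
    have : swap x y = 1 := by simpa using he
    exact hxy (by simpa using (congrArg (fun t => t y) this))
  · intros; simp
  · intro σ _; simp [mul_assoc]

lemma auxH_add {R : Type*} [CommRing R] {k : ℕ}
    (M N : Matrix (Fin k ⊕ Fin k) (Fin k ⊕ Fin k) R) :
    auxH (M + N) = ∑ t : Finset (Fin k), ∑ σ : Perm (Fin k ⊕ Fin k), ((Perm.sign σ : ℤ) : R) *
      ((∏ i ∈ t, M (σ (Sum.inl i)) (σ (Sum.inr i))) *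
        ∏ i ∈ tᶜ, N (σ (Sum.inl i)) (σ (Sum.inr i))) := by
  unfold auxH
  simp_rw [Matrix.add_apply, Fintype.prod_add, mul_sum]
  rw [sum_comm]

lemma auxH_add_symm {R : Type*} [CommRing R] {k : ℕ}
    (M N : Matrix (Fin k ⊕ Fin k) (Fin k ⊕ Fin k) R) (hN : ∀ i j, N i j = N j i) :
    auxH (M + N) = auxH M := by
  rw [auxH_add, sum_eq_single univ]
  · simp [auxH]
  · intro t _ ht
    obtain ⟨i, hi⟩ : ∃ i, i ∉ t := by
      by_contra! h
      exact ht (by ext; simp [h])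
    apply aux_vanish _ (Sum.inl i) (Sum.inr i) (by simp)
    intro σ
    congr 1
    · apply prod_congr rfl; intro j hj
      have : j ≠ i := fun h => hi (h ▸ hj)
      rw [Perm.mul_apply, Perm.mul_apply, swap_apply_of_ne_of_ne (by simpa) (by simp),
        swap_apply_of_ne_of_ne (by simp) (by simpa)]
    · apply prod_congr rfl; intro j hj
      by_cases h : j = i
      · subst h
        simp [hN]
      · rw [Perm.mul_apply, Perm.mul_apply, swap_apply_of_ne_of_ne (by simpa) (by simp),
          swap_apply_of_ne_of_ne (by simp) (by simpa)]
  · simp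

lemma auxH_affine {R : Type*} [CommRing R] {k : ℕ}
    (M : Matrix (Fin k ⊕ Fin k) (Fin k ⊕ Fin k) R) (u v : Fin k ⊕ Fin k → R) :
    auxH (M + vecMulVec u v) + auxH (M - vecMulVec u v) = 2 * auxH M := by
  have h0 : 2 * auxH M = ∑ t : Finset (Fin k), if t = univ then 2 * auxH M else 0 := by simp
  rw [sub_eq_add_neg, auxH_add, auxH_add, ← sum_add_distrib, h0]
  apply sum_congr rfl; intro t _
  split_ifs with ht
  · subst ht
    simp [auxH, two_mul]
  · by_cases h1 : ∃ i j, i ≠ j ∧ i ∉ t ∧ j ∉ t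
    · obtain ⟨i, j, hij, hi, hj⟩ := h1
      have key : ∀ w : Fin k ⊕ Fin k → R, ∑ σ : Perm (Fin k ⊕ Fin k), ((Perm.sign σ : ℤ) : R) *
          ((∏ i ∈ t, M (σ (Sum.inl i)) (σ (Sum.inr i))) *
          ∏ i ∈ tᶜ, (vecMulVec w v) (σ (Sum.inl i)) (σ (Sum.inr i))) = 0 := by
        intro w
        apply aux_vanish _ (Sum.inl i) (Sum.inl j) (by simpa)
        intro σ
        congr 1
        · apply prod_congr rfl; intro l hl
          have h1 : l ≠ i := fun h => hi (h ▸ hl)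
          have h2 : l ≠ j := fun h => hj (h ▸ hl)
          rw [Perm.mul_apply, Perm.mul_apply, swap_apply_of_ne_of_ne (by simpa) (by simpa),
            swap_apply_of_ne_of_ne (by simp) (by simp)]
        · simp only [vecMulVec_apply, prod_mul_distrib]
          congr 1
          · apply prod_bijective (swap i j) (swap i j).bijective
            · intro l
              simp only [mem_compl]
              by_cases h1 : l = i
              · subst h1; simp [hi, hj]
              by_cases h2 : l = j
              · subst h2; simp [hi, hj]
              rw [swap_apply_of_ne_of_ne h1 h2]
            · intro l _
              by_cases h1 : l = i
              · subst h1; simp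
              by_cases h2 : l = j
              · subst h2; simp
              rw [swap_apply_of_ne_of_ne h1 h2, Perm.mul_apply,
                swap_apply_of_ne_of_ne (by simpa) (by simpa)]
      rw [← neg_vecMulVec, key, key, add_zero]
    · push Not at h1
      obtain ⟨i, hi⟩ : ∃ i, i ∉ t := by
        by_contra! h
        exact ht (by ext; simp [h])
      have : tᶜ = {i} := by
        ext j
        simp only [mem_compl, mem_singleton]
        constructor
        · intro hj
          by_contra hne
          exact hj (h1 i j (Ne.symm hne) hi)
        · rintro rfl; exact hi
      rw [this]
      simp

lemma auxDet_affine {R : Type*} [CommRing R] {α : Type*} [DecidableEq α] [Fintype α]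
    (Z : Matrix α α R) (u v : α → R) :
    (Z + vecMulVec u v).det + (Z - vecMulVec u v).det = 2 * Z.det := by
  have key : ∀ w : α → R, (Z - vecMulVec u w).det =
      (fromBlocks Z (replicateCol Unit u) (replicateRow Unit w) 1).det := by
    intro w
    rw [det_fromBlocks_one₂₂]
    congr 2
    ext i j; simp [Matrix.mul_apply, vecMulVec_apply]
  have e1 : Z + vecMulVec u v = Z - vecMulVec u (-v) := by simp [vecMulVec_neg]
  rw [e1, key, key]
  have e2 : ∀ w : α → R, fromBlocks Z (replicateCol Unit u) (replicateRow Unit w) 1 =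
      updateRow (fromBlocks Z (replicateCol Unit u) (replicateRow Unit w) 1) (Sum.inr ())
        (Sum.elim w 1) := by
    intro w; ext (i | i) (j | j) <;> simp [updateRow_apply]
  have e3 : ∀ w w' r : _, updateRow (fromBlocks Z (replicateCol Unit u) (replicateRow Unit w) 1)
      (Sum.inr ()) r = updateRow (fromBlocks Z (replicateCol Unit u) (replicateRow Unit w') 1)
      (Sum.inr ()) r := by
    intro w w' r; ext (i | i) (j | j) <;> simp [updateRow_apply]
  rw [e2 v, e2 (-v), e3 v 0, e3 (-v) 0, ← det_updateRow_add]
  have e4 : (Sum.elim (-v) 1 + Sum.elim v 1 : α ⊕ Unit → R) = (2 : R) • Sum.elim (0 : α → R) (1 : Unit → R) := by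
    ext (i | i) <;> simp
    norm_num
  rw [e4, det_updateRow_smul, ← e2]
  simp

lemma auxNormalForm {K : Type*} [Field K] {α : Type*} [DecidableEq α] [Fintype α] (j : ℕ) :
    ∀ (S : Matrix α α K) (T : Finset α), (∀ r s, S r s = - S s r) → (∀ r, S r r = 0) →
      (∀ r s, r ∉ T → S r s = 0) → T.card ≤ 2 * j →
      ∃ C B : Matrix α (Fin j) K, S = C * Bᵀ - B * Cᵀ := by
  induction j with
  | zero =>
    intro S T hs h0 hT hc
    refine ⟨0, 0, ?_⟩
    have : T = ∅ := by simpa using hc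
    subst this
    ext r s
    simp [hT r s]
  | succ j ih =>
    intro S T hs h0 hT hc
    by_cases hS : S = 0
    · exact ⟨0, 0, by simp [hS]⟩
    obtain ⟨p, q, hpq⟩ : ∃ p q, S p q ≠ 0 := by
      by_contra! h
      exact hS (by ext; simp [h])
    have hne : p ≠ q := by rintro rfl; exact hpq (h0 p)
    have hp : p ∈ T := by by_contra h; exact hpq (hT p q h)
    have hq : q ∈ T := by by_contra h; exact hpq (by rw [hs, hT q p h, neg_zero])
    obtain ⟨C, B, hCB⟩ := ih
      (Matrix.of fun r s => S r s - (S r p * S s q - S r q * S s p) / S p q)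
      ((T.erase p).erase q)
      (by intro r s; simp only [of_apply]; rw [hs r s]; ring)
      (by intro r; simp only [of_apply]; rw [h0]; ring)
      (by
        intro r s hr
        simp only [of_apply]
        by_cases h1 : r = q
        · subst h1
          rw [h0 r, hs r p, hs s r]; field_simp; ring
        by_cases h2 : r = p
        · subst h2
          rw [h0 r, hs s r]; field_simp; ring
        have : r ∉ T := by
          intro h; exact hr (by simp [h1, h2, h])
        simp [hT r _ this])
      (by
        rw [card_erase_of_mem (by simp [hne.symm, hq]), card_erase_of_mem hp]; omega)
    refine ⟨Matrix.of fun r => Fin.cons (S r p) (C r),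
      Matrix.of fun r => Fin.cons (S r q / S p q) (B r), ?_⟩
    ext r s
    have := congrFun (congrFun hCB r) s
    simp only [of_apply, Matrix.sub_apply, Matrix.mul_apply, transpose_apply] at this
    simp only [Matrix.sub_apply, Matrix.mul_apply, transpose_apply, of_apply, Fin.sum_univ_succ,
      Fin.cons_zero, Fin.cons_succ]
    linear_combination this

lemma auxIncr_self (k : ℕ) : incrFuns k k = {id} := by
  ext f
  simp only [incrFuns, mem_filter, mem_univ, true_and, mem_singleton]
  constructor
  · intro h
    have hm : StrictMono f := fun a b => h a b
    have hsurj : Function.Surjective f := Finite.surjective_of_injective hm.injective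
    exact (hm.range_inj strictMono_id).1 (by rw [hsurj.range_eq, Set.range_id])
  · rintro rfl a b h; exact h

lemma auxH_sq {K : Type*} [Field K] [CharZero K] {k : ℕ}
    (M : Matrix (Fin k ⊕ Fin k) (Fin k ⊕ Fin k) K) :
    auxH M ^ 2 = (k.factorial : K) ^ 2 * (M - Mᵀ).det := by
  obtain ⟨C, B, hCB⟩ := auxNormalForm k (M - Mᵀ) univ (by intro r s; simp) (by simp)
    (by simp) (by simp [two_mul])
  have hk : (k.factorial : K) ≠ 0 := by exact_mod_cast k.factorial_ne_zero
  have h1 : auxH M = auxH (C * Bᵀ) := by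
    have := auxH_add_symm (C * Bᵀ) (M - C * Bᵀ) (by
      intro i j
      have h := congrFun (congrFun hCB i) j
      have e : ∀ i j, (B * Cᵀ) i j = (C * Bᵀ) j i := by
        intro i j
        simp [Matrix.mul_apply, mul_comm]
      simp only [Matrix.sub_apply, transpose_apply, e] at h ⊢
      linear_combination h)
    rw [← this]; congr 1; abel
  have h2 : auxH (C * Bᵀ) = k.factorial * (fromCols C B).det := by
    have := auxF_eq C B 1
    rw [Matrix.mul_one] at this
    rw [← mul_left_cancel₀ hk this]
    simp [auxF, auxIncr_self, auxD]
  have h3 : M - Mᵀ = fromCols C B * (-(Matrix.J (Fin k) K)) * (fromCols C B)ᵀ := by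
    rw [hCB, Matrix.J, fromBlocks_neg, fromCols_mul_fromBlocks, transpose_fromCols,
      fromCols_mul_fromRows]
    simp [sub_eq_add_neg, add_comm]
  have h4 : (-(Matrix.J (Fin k) K)).det = 1 := by
    rw [det_neg, SymplecticGroup.det_eq_one (SymplecticGroup.J_mem _ _)]
    simp [← two_mul]
  rw [h1, h2, h3, det_mul, det_mul, det_transpose, h4]
  ring

lemma auxMain {K : Type*} [Field K] [CharZero K] {k n : ℕ}
    (A B : Matrix (Fin k ⊕ Fin k) (Fin n) K) (X : Matrix (Fin n) (Fin n) K) :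
    (A * X * Bᵀ + B * (allOnes K n - Xᵀ) * Aᵀ).det = auxF A B X * auxF B A (allOnes K n - Xᵀ) := by
  have hk : (k.factorial : K) ≠ 0 := by exact_mod_cast k.factorial_ne_zero
  have f1 := mul_left_cancel₀ hk (auxF_eq A B X)
  have f2 := mul_left_cancel₀ hk (auxF_eq B A (allOnes K n - Xᵀ))
  set M := A * X * Bᵀ with hM
  set b : Fin k ⊕ Fin k → K := fun i => ∑ j, B i j with hb
  set a : Fin k ⊕ Fin k → K := fun i => ∑ j, A i j with ha
  set S := M - Mᵀ with hS
  have hJ : B * (allOnes K n - Xᵀ) * Aᵀ = vecMulVec b a - Mᵀ := by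
    rw [Matrix.mul_sub, Matrix.sub_mul, hM]
    congr 1
    · ext i j
      simp [Matrix.mul_apply, allOnes, vecMulVec_apply, hb, ha, mul_sum]
    · simp [transpose_mul, Matrix.mul_assoc]
  rw [hJ] at f2 ⊢
  have e0 : M + (vecMulVec b a - Mᵀ) = S + vecMulVec b a := by rw [hS]; abel
  rw [e0]
  have g2 : auxH (vecMulVec b a - Mᵀ) = auxH (M + vecMulVec b a) := by
    rw [← auxH_add_symm (vecMulVec b a - Mᵀ) (M + Mᵀ) (by intro i j; simp [add_comm])]
    congr 1; abel
  rw [g2] at f2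
  have q0 := auxH_sq M
  have q1 := auxH_sq (M + vecMulVec b a)
  have q2 := auxH_sq (M - vecMulVec b a)
  have q3 := auxH_affine M b a
  have t1 : M + vecMulVec b a - (M + vecMulVec b a)ᵀ = S + vecMulVec b a - vecMulVec a b := by
    rw [transpose_add, transpose_vecMulVec, hS]; abel
  have t2 : M - vecMulVec b a - (M - vecMulVec b a)ᵀ = S - vecMulVec b a + vecMulVec a b := by
    rw [transpose_sub, transpose_vecMulVec, hS]; abel
  rw [t1] at q1
  rw [t2] at q2
  rw [← hS] at q0
  have ST : Sᵀ = -S := by rw [hS]; simp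
  have dneg : ∀ Z : Matrix (Fin k ⊕ Fin k) (Fin k ⊕ Fin k) K, (-Zᵀ).det = Z.det := by
    intro Z; rw [det_neg, det_transpose]; simp [← two_mul]
  have d1 := auxDet_affine (S - vecMulVec a b) b a
  have d2 := auxDet_affine (S + vecMulVec a b) b a
  have d3 := auxDet_affine S a b
  have d4 : (S - vecMulVec a b).det = (S + vecMulVec b a).det := by
    rw [← dneg]; congr 1
    rw [transpose_sub, transpose_vecMulVec, ST]; abel
  have d5 : (S - vecMulVec a b - vecMulVec b a).det = (S + vecMulVec a b + vecMulVec b a).det := by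
    rw [← dneg]; congr 1
    rw [transpose_sub, transpose_sub, transpose_vecMulVec, transpose_vecMulVec, ST]; abel
  have c1 : S + vecMulVec b a - vecMulVec a b = S - vecMulVec a b + vecMulVec b a := by abel
  have c2 : S - vecMulVec b a + vecMulVec a b = S + vecMulVec a b - vecMulVec b a := by abel
  rw [c1] at q1
  rw [c2] at q2
  apply mul_left_cancel₀ (pow_ne_zero 2 hk)
  have f3 : (k.factorial : K) ^ 2 * (auxF A B X * auxF B A (allOnes K n - Xᵀ)) =
      auxH M * auxH (M + vecMulVec b a) := by rw [← f1, ← f2]; ring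
  rw [f3]
  generalize (S - vecMulVec a b + vecMulVec b a).det = D11 at *
  generalize (S + vecMulVec a b - vecMulVec b a).det = Dmm at *
  generalize (S - vecMulVec a b - vecMulVec b a).det = Dx at *
  generalize (S + vecMulVec a b + vecMulVec b a).det = Dy at *
  generalize (S - vecMulVec a b).det = D01 at *
  generalize (S + vecMulVec a b).det = D0m at *
  generalize (S + vecMulVec b a).det = D10 at *
  generalize S.det = D00 at *
  generalize auxH (M + vecMulVec b a) = x at *
  generalize auxH (M - vecMulVec b a) = y at *
  generalize auxH M = u at *
  have hy : y = 2 * u - x := by linear_combination q3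
  have hD : D11 - Dmm = 4 * (D10 - D00) := by
    linear_combination d1 - d2 - 2 * d3 - d5 + 4 * d4
  subst hy
  have h4 : (4 : K) ≠ 0 := by norm_num
  apply mul_left_cancel₀ h4
  linear_combination q2 - q1 - 4 * q0 - (k.factorial : K) ^ 2 * hD

/-- index equivalence -/
def auxE (k : ℕ) : Fin k ⊕ Fin k ≃ Fin (2 * k) :=
  finSumFinEquiv.trans (finCongr (two_mul k).symm)

lemma auxF_fAB {R : Type*} [CommRing R] {k n : ℕ} (A B : Matrix (Fin (2*k)) (Fin n) R)
    (X : Matrix (Fin n) (Fin n) R) :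
    fAB A B X = auxF (A.submatrix (auxE k) id) (B.submatrix (auxE k) id) X := by
  unfold fAB auxF
  apply sum_congr rfl; intro f _
  apply sum_congr rfl; intro g _
  congr 1
  rw [← det_submatrix_equiv_self (auxE k)]
  unfold auxD
  congr 1
  ext i (j | j) <;> simp [concatCB, auxE]

lemma fAB_map {R R' : Type*} [CommRing R] [CommRing R'] (φ : R →+* R') {k n : ℕ}
    (A B : Matrix (Fin (2*k)) (Fin n) R) (X : Matrix (Fin n) (Fin n) R) :
    φ (fAB A B X) = fAB (A.map φ) (B.map φ) (X.map φ) := by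
  unfold fAB
  simp only [map_sum, map_mul, RingHom.map_det]
  apply sum_congr rfl; intro f _
  apply sum_congr rfl; intro g _
  congr 2
  ext i j
  simp only [concatCB, RingHom.mapMatrix_apply, map_apply, of_apply]
  split_ifs <;> rfl

lemma lhs_map {R R' : Type*} [CommRing R] [CommRing R'] (φ : R →+* R') {k n : ℕ}
    (A B : Matrix (Fin (2*k)) (Fin n) R) (X : Matrix (Fin n) (Fin n) R) :
    φ (A * X * Bᵀ + B * (allOnes R n - Xᵀ) * Aᵀ).det =
    (A.map φ * X.map φ * (B.map φ)ᵀ + B.map φ * (allOnes R' n - (X.map φ)ᵀ) * (A.map φ)ᵀ).det := by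
  rw [RingHom.map_det]
  congr 1
  ext i j
  simp [Matrix.mul_apply, allOnes]

lemma allOnes_map {R R' : Type*} [CommRing R] [CommRing R'] (φ : R →+* R') {n : ℕ}
    (X : Matrix (Fin n) (Fin n) R) :
    (allOnes R n - Xᵀ).map φ = allOnes R' n - (X.map φ)ᵀ := by
  ext i j
  simp [allOnes]

lemma auxField {K : Type*} [Field K] [CharZero K] {k n : ℕ}
    (A B : Matrix (Fin (2*k)) (Fin n) K) (X : Matrix (Fin n) (Fin n) K) :
    (A * X * Bᵀ + B * (allOnes K n - Xᵀ) * Aᵀ).det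
      = fAB A B X * fAB B A (allOnes K n - Xᵀ) := by
  rw [auxF_fAB, auxF_fAB, ← auxMain, ← det_submatrix_equiv_self (auxE k)]
  congr 1

lemma auxDomain {R : Type*} [CommRing R] [IsDomain R] [CharZero R] {k n : ℕ}
    (A B : Matrix (Fin (2*k)) (Fin n) R) (X : Matrix (Fin n) (Fin n) R) :
    (A * X * Bᵀ + B * (allOnes R n - Xᵀ) * Aᵀ).det
      = fAB A B X * fAB B A (allOnes R n - Xᵀ) := by
  have : CharZero (FractionRing R) := IsFractionRing.charZero R
  apply IsFractionRing.injective R (FractionRing R)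
  rw [lhs_map, map_mul, fAB_map, fAB_map, allOnes_map, auxField]

end Helpers

/-- Theorem (main theorem, even case): for `m = 2k` even,
`det(A·X·Bᵗ + B·(𝒥 − Xᵗ)·Aᵗ) = f_{A,B}(X) · f_{B,A}(𝒥 − Xᵗ)`. -/
theorem det_eq_fAB_mul_fBA_even {R : Type*} [CommRing R] (k n : ℕ) (hk : 0 < k) (hn : 0 < n)
    (A B : Matrix (Fin (2*k)) (Fin n) R) (X : Matrix (Fin n) (Fin n) R) :
    (A * X * Bᵀ + B * (allOnes R n - Xᵀ) * Aᵀ).det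
      = fAB A B X * fAB B A (allOnes R n - Xᵀ) := by
  let V := ((Fin (2*k) × Fin n) ⊕ (Fin (2*k) × Fin n)) ⊕ (Fin n × Fin n)
  let A' : Matrix (Fin (2*k)) (Fin n) (MvPolynomial V ℤ) :=
    Matrix.of fun i j => MvPolynomial.X (Sum.inl (Sum.inl (i, j)))
  let B' : Matrix (Fin (2*k)) (Fin n) (MvPolynomial V ℤ) :=
    Matrix.of fun i j => MvPolynomial.X (Sum.inl (Sum.inr (i, j)))
  let X' : Matrix (Fin n) (Fin n) (MvPolynomial V ℤ) :=
    Matrix.of fun i j => MvPolynomial.X (Sum.inr (i, j))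
  let φ : MvPolynomial V ℤ →+* R := MvPolynomial.eval₂Hom (Int.castRingHom R)
    (Sum.elim (Sum.elim (fun p => A p.1 p.2) (fun p => B p.1 p.2)) (fun p => X p.1 p.2))
  have hA : A'.map φ = A := by ext i j; simp [A', φ]
  have hB : B'.map φ = B := by ext i j; simp [B', φ]
  have hX : X'.map φ = X := by ext i j; simp [X', φ]
  have key := congrArg φ (auxDomain A' B' X')
  rwa [lhs_map, map_mul, fAB_map, fAB_map, allOnes_map, hA, hB, hX] at key
end

section
/- Let m and n be positive integers with m even, let A and B be m×n matrices and X an n×n matrix over a commutative ring. Then Pf(A·X·Bᵗ − B·Xᵗ·Aᵗ) = (−1)^{binom(m/2, 2)} · f_{A,B}(X). -/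
open Matrix

/-- The Pfaffian of a `2k × 2k` matrix, defined as the sum over perfect matchings
of `{1, …, 2k}` (encoded by the permutation listing the matched pairs
`(σ(1),σ(2)), (σ(3),σ(4)), …` in normal form, whose sign equals
`(−1)^{cr(μ)}` for the matching `μ`) of the sign of the matching times the
product of the corresponding matrix entries. -/
def pfaffian {R : Type*} [CommRing R] {k : ℕ} (Y : Matrix (Fin (2*k)) (Fin (2*k)) R) : R :=
  ∑ σ ∈ Finset.univ.filter (fun σ : Equiv.Perm (Fin (2*k)) =>
      (∀ i : Fin k,
        σ ⟨2*(i:ℕ), by have := i.isLt; omega⟩ < σ ⟨2*(i:ℕ)+1, by have := i.isLt; omega⟩) ∧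
      (∀ i j : Fin k, i < j →
        σ ⟨2*(i:ℕ), by have := i.isLt; omega⟩ < σ ⟨2*(j:ℕ), by have := j.isLt; omega⟩)),
    ((Equiv.Perm.sign σ : ℤ) : R) *
      ∏ i : Fin k, Y (σ ⟨2*(i:ℕ), by have := i.isLt; omega⟩) (σ ⟨2*(i:ℕ)+1, by have := i.isLt; omega⟩)

namespace PfAux

open Finset Equiv

theorem sum_transversal {Ω ι M : Type*} [Fintype Ω] [Fintype ι] [AddCommMonoid M]
    (act : ι → Ω ≃ Ω) (P D : Ω → Prop) [DecidablePred P] [DecidablePred D]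
    (h1 : ∀ ω, D ω → ∃! i, P (act i ω)) (h2 : ∀ i ω, P (act i ω) → D ω) (F : Ω → M) :
    ∑ ω with D ω, F ω = ∑ i, ∑ ω with P ω, F ((act i).symm ω) := by
  classical
  have : ∀ i, ∑ ω with P ω, F ((act i).symm ω) = ∑ ω, if P (act i ω) then F ω else 0 := by
    intro i
    rw [sum_filter, ← (act i).sum_comp]
    simp
  simp_rw [this]
  rw [sum_comm, sum_filter]
  refine sum_congr rfl fun ω _ => ?_
  split_ifs with h
  · obtain ⟨i, hi, hu⟩ := h1 ω h
    rw [sum_eq_single i, if_pos hi]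
    · intro j _ hj
      rw [if_neg]
      exact fun hP => hj (hu j hP)
    · simp
  · symm
    refine sum_eq_zero fun i _ => ?_
    rw [if_neg]
    exact fun hP => h (h2 i ω hP)

theorem existsUnique_sort {k : ℕ} {L : Type*} [LinearOrder L] (a : Fin k → L)
    (ha : Function.Injective a) : ∃! π : Perm (Fin k), StrictMono (a ∘ π) := by
  refine ⟨Tuple.sort a, (Tuple.monotone_sort a).strictMono_of_injective
    (ha.comp (Equiv.injective _)), ?_⟩
  intro τ hτ
  have := Tuple.unique_monotone hτ.monotone (Tuple.monotone_sort a)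
  ext i
  have := congrFun this i
  exact congrArg Fin.val (ha this)

def pe (k : ℕ) : Fin k × Bool ≃ Fin (2*k) where
  toFun p := ⟨2*(p.1:ℕ) + (if p.2 then 1 else 0), by have := p.1.isLt; split_ifs <;> omega⟩
  invFun x := (⟨(x:ℕ)/2, by have := x.isLt; omega⟩, decide ((x:ℕ) % 2 = 1))
  left_inv := by
    rintro ⟨i, b⟩
    cases b
    · simp
    · simp; ext; simp; omega
  right_inv := by
    intro x
    ext
    simp only [decide_eq_true_eq]
    split_ifs <;> omega

def ce (k : ℕ) : Fin k ⊕ Fin k ≃ Fin (2*k) where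
  toFun := Sum.elim (fun i => ⟨i, by have := i.isLt; omega⟩)
    (fun i => ⟨i + k, by have := i.isLt; omega⟩)
  invFun x := if h : (x:ℕ) < k then Sum.inl ⟨x, h⟩ else
    Sum.inr ⟨(x:ℕ) - k, by have := x.isLt; omega⟩
  left_inv := by
    rintro (i | i) <;> simp
  right_inv := by
    intro x
    by_cases h : (x:ℕ) < k
    · simp [h]
    · simp [h]; ext; simp; omega

theorem pe_false {k : ℕ} (i : Fin k) : pe k (i, false) = ⟨2*(i:ℕ), by have := i.isLt; omega⟩ := rfl
theorem pe_true {k : ℕ} (i : Fin k) :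
    pe k (i, true) = ⟨2*(i:ℕ)+1, by have := i.isLt; omega⟩ := rfl

section
variable {R : Type*} [CommRing R] {k n : ℕ}

theorem concat_inl (A B : Matrix (Fin (2*k)) (Fin n) R) (f g : Fin k → Fin n) (r) (i : Fin k) :
    concatCB A B f g r (ce k (Sum.inl i)) = A r (f i) := by
  simp [concatCB, ce]

theorem concat_inr (A B : Matrix (Fin (2*k)) (Fin n) R) (f g : Fin k → Fin n) (r) (i : Fin k) :
    concatCB A B f g r (ce k (Sum.inr i)) = B r (g i) := by
  simp [concatCB, ce]

theorem det_concat_perm (A B : Matrix (Fin (2*k)) (Fin n) R) (f g : Fin k → Fin n)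
    (π ρ : Perm (Fin k)) :
    (concatCB A B (f ∘ π) (g ∘ ρ)).det =
      ((Perm.sign π : ℤ) : R) * ((Perm.sign ρ : ℤ) : R) * (concatCB A B f g).det := by
  have : concatCB A B (f ∘ π) (g ∘ ρ) =
      (concatCB A B f g).submatrix id ((ce k).permCongr (Equiv.sumCongr π ρ)) := by
    ext r c
    obtain ⟨x, rfl⟩ := (ce k).surjective c
    rcases x with i | i <;>
    simp [concat_inl, concat_inr, Equiv.permCongr_apply]
  rw [this, Matrix.det_permute', Perm.sign_permCongr, Perm.sign_sumCongr]
  push_cast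
  ring

theorem det_concat_zero_left (A B : Matrix (Fin (2*k)) (Fin n) R) (f g : Fin k → Fin n)
    (h : ¬ Function.Injective f) : (concatCB A B f g).det = 0 := by
  simp only [Function.Injective, not_forall] at h
  obtain ⟨i, j, hij, hne⟩ := h
  apply Matrix.det_zero_of_column_eq (i := ce k (Sum.inl i)) (j := ce k (Sum.inl j))
  · simpa using hne
  · intro r; rw [concat_inl, concat_inl, hij]

theorem det_concat_zero_right (A B : Matrix (Fin (2*k)) (Fin n) R) (f g : Fin k → Fin n)
    (h : ¬ Function.Injective g) : (concatCB A B f g).det = 0 := by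
  simp only [Function.Injective, not_forall] at h
  obtain ⟨i, j, hij, hne⟩ := h
  apply Matrix.det_zero_of_column_eq (i := ce k (Sum.inr i)) (j := ce k (Sum.inr j))
  · simpa using hne
  · intro r; rw [concat_inr, concat_inr, hij]

theorem sum_injective {M : Type*} [AddCommMonoid M] (F : (Fin k → Fin n) → M)
    (h0 : ∀ f, ¬ Function.Injective f → F f = 0) :
    ∑ f, F f = ∑ π : Perm (Fin k), ∑ f ∈ incrFuns k n, F (f ∘ π) := by
  classical
  have key := sum_transversal (ι := Perm (Fin k))
    (fun π => (Equiv.arrowCongr π.symm (Equiv.refl (Fin n))))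
    (fun f : Fin k → Fin n => ∀ a b : Fin k, a < b → f a < f b) Function.Injective
    (by
      intro f hf
      exact existsUnique_sort f hf)
    (by
      intro π f hf
      have h : StrictMono (f ∘ π) := hf
      have := h.injective
      exact (Function.Injective.of_comp_iff' f π.bijective).1 this) F
  rw [← sum_filter_of_ne (p := Function.Injective) (s := univ) (f := F), key]
  · rw [← Equiv.sum_comp (Equiv.inv (Perm (Fin k)))]
    refine sum_congr rfl fun π _ => ?_
    unfold incrFuns
    refine sum_congr rfl fun f _ => ?_
    congr 1
  · intro f _ hf
    by_contra h
    exact hf (h0 f h)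

theorem sum_fg (A B : Matrix (Fin (2*k)) (Fin n) R) (X : Matrix (Fin n) (Fin n) R) :
    ∑ f : Fin k → Fin n, ∑ g : Fin k → Fin n, (∏ i, X (f i) (g i)) * (concatCB A B f g).det
      = (k.factorial : R) * fAB A B X := by
  rw [sum_injective]
  swap
  · intro f hf
    refine sum_eq_zero fun g _ => ?_
    rw [det_concat_zero_left _ _ _ _ hf, mul_zero]
  have h1 : ∀ (π : Perm (Fin k)) (f : Fin k → Fin n),
      ∑ g : Fin k → Fin n, (∏ i, X ((f ∘ π) i) (g i)) * (concatCB A B (f ∘ π) g).det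
      = ∑ g : Fin k → Fin n, (∏ i, X (f i) (g i)) * (concatCB A B f g).det := by
    intro π f
    rw [← Equiv.sum_comp (Equiv.arrowCongr π.symm (Equiv.refl (Fin n)))]
    refine sum_congr rfl fun g _ => ?_
    have : (Equiv.arrowCongr π.symm (Equiv.refl (Fin n))) g = g ∘ π := rfl
    rw [this, det_concat_perm]
    congr 1
    · exact Equiv.prod_comp π (fun i => X (f i) (g i))
    · rw [← Int.cast_mul, ← Units.val_mul, Int.units_mul_self]; simp
  simp_rw [h1]
  rw [sum_const, card_univ, Fintype.card_perm, Fintype.card_fin, nsmul_eq_mul]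
  congr 1
  unfold fAB
  refine sum_congr rfl fun f _ => ?_
  rw [sum_injective]
  swap
  · intro g hg
    rw [det_concat_zero_right _ _ _ _ hg, mul_zero]
  rw [sum_comm]
  refine sum_congr rfl fun g _ => ?_
  rw [← Matrix.det_transpose, Matrix.det_apply', sum_mul]
  refine sum_congr rfl fun π _ => ?_
  have := det_concat_perm A B f g 1 π
  rw [Perm.coe_one, Function.comp_id] at this
  rw [this]
  simp
  ring

def flip (ε : Fin k → Bool) : Perm (Fin (2*k)) :=
  (pe k).permCongr (Equiv.prodCongrRight fun i => if ε i then Equiv.boolNot else 1)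

def pperm (π : Perm (Fin k)) : Perm (Fin (2*k)) :=
  (pe k).permCongr (Equiv.prodCongrLeft fun _ => π)

theorem flip_pe (ε : Fin k → Bool) (i b) : flip ε (pe k (i, b)) = pe k (i, xor b (ε i)) := by
  simp only [flip, Equiv.permCongr_apply, Equiv.symm_apply_apply, Equiv.prodCongrRight_apply]
  cases h : ε i <;> simp

theorem pperm_pe (π : Perm (Fin k)) (i b) : pperm π (pe k (i, b)) = pe k (π i, b) := by
  simp [pperm, Equiv.permCongr_apply]

theorem sign_flip (ε : Fin k → Bool) :
    Perm.sign (flip ε) = ∏ i, if ε i then -1 else 1 := by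
  rw [flip, Perm.sign_permCongr, Perm.sign_prodCongrRight]
  refine prod_congr rfl fun i _ => ?_
  split_ifs
  · decide
  · simp

theorem sign_pperm (π : Perm (Fin k)) : Perm.sign (pperm π) = 1 := by
  rw [pperm, Perm.sign_permCongr, Perm.sign_prodCongrLeft]
  simp

theorem flip_inv (ε : Fin k → Bool) : (flip ε)⁻¹ = flip ε := by
  rw [inv_eq_iff_mul_eq_one]
  ext x
  obtain ⟨⟨i, b⟩, rfl⟩ := (pe k).surjective x
  simp [flip_pe]

def Ordd (σ : Perm (Fin (2*k))) : Prop := ∀ i, σ (pe k (i, false)) < σ (pe k (i, true))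

def Norm (σ : Perm (Fin (2*k))) : Prop :=
  Ordd σ ∧ ∀ i j : Fin k, i < j → σ (pe k (i, false)) < σ (pe k (j, false))

theorem sum_flip {M : Type*} [AddCommMonoid M] [DecidablePred (Ordd (k := k))]
    (F : Perm (Fin (2*k)) → M) :
    ∑ σ, F σ = ∑ ε : Fin k → Bool, ∑ σ with Ordd σ, F (σ * flip ε) := by
  have key := sum_transversal (ι := Fin k → Bool)
    (fun ε => Equiv.mulRight (flip ε)) (Ordd (k := k)) (fun _ => True)
    (by
      intro σ _
      have hne : ∀ i, σ (pe k (i, false)) ≠ σ (pe k (i, true)) := by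
        intro i h
        simpa using h
      refine ⟨fun i => decide (σ (pe k (i, true)) < σ (pe k (i, false))), ?_, ?_⟩
      · intro i
        have := hne i
        simp only [Equiv.coe_mulRight, Perm.mul_apply, flip_pe]
        by_cases h : σ (pe k (i, true)) < σ (pe k (i, false))
        · simp [h]
        · simp only [h]
          simpa using lt_of_le_of_ne (not_lt.1 h) this
      · intro ε hε
        funext i
        have := hε i
        simp only [Equiv.coe_mulRight, Perm.mul_apply, flip_pe] at this
        cases h : ε i
        · simp [h] at this
          simpa using this.le
        · simp [h] at this
          simpa using this)
    (fun _ _ _ => trivial) F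
  rw [filter_true] at key
  rw [key]
  refine sum_congr rfl fun ε _ => sum_congr rfl fun σ _ => ?_
  congr 1
  rw [Equiv.symm_apply_eq]
  have : flip ε * flip ε = 1 := by
    conv_lhs => enter [1]; rw [← flip_inv]
    simp
  simp [mul_assoc, this]

theorem sum_norm [DecidablePred (Ordd (k := k))] [DecidablePred (Norm (k := k))]
    (F : Perm (Fin (2*k)) → R) (hF : ∀ σ π, F (σ * pperm π) = F σ) :
    ∑ σ with Ordd σ, F σ = (k.factorial : R) * ∑ σ with Norm σ, F σ := by
  have hO : ∀ (σ : Perm (Fin (2*k))) π, Ordd (σ * pperm π) ↔ Ordd σ := by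
    intro σ π
    simp only [Ordd, Perm.mul_apply, pperm_pe]
    exact π.forall_congr_right (q := fun i => σ (pe k (i, false)) < σ (pe k (i, true)))
  have key := sum_transversal (ι := Perm (Fin k))
    (fun π => Equiv.mulRight (pperm π)) (Norm (k := k)) (Ordd (k := k))
    (by
      intro σ hσ
      obtain ⟨π, h, hu⟩ := existsUnique_sort (fun i => σ (pe k (i, false)))
        (by intro i j h; simpa using h)
      refine ⟨π, ⟨(hO σ π).2 hσ, ?_⟩, ?_⟩
      · intro i j hij
        simp only [Equiv.coe_mulRight, Perm.mul_apply, pperm_pe]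
        exact h hij
      · intro τ hτ
        apply hu
        intro i j hij
        have := hτ.2 i j hij
        simp only [Equiv.coe_mulRight, Perm.mul_apply, pperm_pe] at this
        exact this)
    (fun π σ h => (hO σ π).1 h.1) F
  rw [key]
  have : ∀ (π : Perm (Fin k)) σ, F ((Equiv.mulRight (pperm π)).symm σ) = F σ := by
    intro π σ
    rw [← hF _ π]
    congr 1
    exact (Equiv.mulRight (pperm π)).apply_symm_apply σ
  simp_rw [this]
  rw [sum_const, card_univ, Fintype.card_perm, Fintype.card_fin, nsmul_eq_mul]

theorem fact_mul_pfaffian (Z : Matrix (Fin (2*k)) (Fin (2*k)) R) :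
    (k.factorial : R) * pfaffian (Z - Zᵀ) =
      ∑ σ : Perm (Fin (2*k)), ((Perm.sign σ : ℤ) : R) *
        ∏ i, Z (σ (pe k (i, false))) (σ (pe k (i, true))) := by
  classical
  have h1 : pfaffian (Z - Zᵀ) = ∑ σ with Norm (k := k) σ, ((Perm.sign σ : ℤ) : R) *
        ∏ i, (Z - Zᵀ) (σ (pe k (i, false))) (σ (pe k (i, true))) := by
    unfold pfaffian
    refine sum_congr ?_ fun _ _ => rfl
    ext σ
    simp only [mem_filter]
    rfl
  rw [h1, ← sum_norm, sum_flip, sum_comm]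
  · refine sum_congr rfl fun σ _ => ?_
    have h2 : ∀ i, (Z - Zᵀ) (σ (pe k (i, false))) (σ (pe k (i, true))) =
        ∑ b : Bool, (if b then -1 else 1) *
          Z (σ (pe k (i, xor false b))) (σ (pe k (i, xor true b))) := by
      intro i
      simp
      ring
    simp_rw [h2]
    rw [Fintype.prod_sum, mul_sum]
    refine sum_congr rfl fun ε _ => ?_
    rw [prod_mul_distrib, ← mul_assoc, Perm.sign_mul, sign_flip]
    congr 1
    · push_cast
      congr 1
      refine prod_congr rfl fun i _ => ?_
      split_ifs <;> simp
    · simp only [Perm.mul_apply, flip_pe]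
  · intro σ π
    rw [Perm.sign_mul, sign_pperm, mul_one]
    congr 1
    simp only [Perm.mul_apply, pperm_pe]
    exact Equiv.prod_comp π (fun i => (Z - Zᵀ) (σ (pe k (i, false))) (σ (pe k (i, true))))

def boolSum (k : ℕ) : Fin k × Bool ≃ Fin k ⊕ Fin k :=
  (Equiv.prodComm _ _).trans (Equiv.boolProdEquivSum _)

/-- sends `i` to `2i` and `i+k` to `2i+1` -/
def shuf (k : ℕ) : Perm (Fin (2*k)) := (ce k).symm.trans ((boolSum k).symm.trans (pe k))

theorem shuf_inl (i : Fin k) : shuf k (ce k (Sum.inl i)) = pe k (i, false) := by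
  simp [shuf, boolSum, Equiv.boolProdEquivSum]

theorem shuf_inr (i : Fin k) : shuf k (ce k (Sum.inr i)) = pe k (i, true) := by
  simp [shuf, boolSum, Equiv.boolProdEquivSum]

theorem sign_shuf : Perm.sign (shuf k) = (-1) ^ (k.choose 2) := by
  rw [Perm.sign_eq_prod_prod_Ioi]
  have h1 : ∀ i : Fin (2*k), (∏ j ∈ Ioi i, if shuf k i < shuf k j then (1 : ℤˣ) else -1) =
      ∏ j, if i < j ∧ ¬ (shuf k i < shuf k j) then -1 else 1 := by
    intro i
    have : Ioi i = univ.filter (fun j => i < j) := by ext; simp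
    rw [this, prod_filter]
    refine prod_congr rfl fun j _ => ?_
    by_cases h : i < j <;> by_cases h' : shuf k i < shuf k j <;> simp [h, h']
  simp_rw [h1]
  rw [← Equiv.prod_comp (ce k)]
  have h3 : ∀ i : Fin (2*k), (∏ j, if i < j ∧ ¬ (shuf k i < shuf k j) then (-1 : ℤˣ) else 1) =
      ∏ x, if i < ce k x ∧ ¬ (shuf k i < shuf k (ce k x)) then -1 else 1 := fun i =>
    (Equiv.prod_comp (ce k) (fun j => if i < j ∧ ¬ (shuf k i < shuf k j) then (-1 : ℤˣ) else 1)).symm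
  simp_rw [h3]
  simp only [Fintype.prod_sum_type, shuf_inl, shuf_inr]
  have e1 : ∀ i j : Fin k, ¬ (ce k (Sum.inl i) < ce k (Sum.inl j) ∧
      ¬ (pe k (i, false) < pe k (j, false))) := by
    intro i j; simp [ce, pe]
  have e2 : ∀ i j : Fin k, ¬ (ce k (Sum.inr i) < ce k (Sum.inr j) ∧
      ¬ (pe k (i, true) < pe k (j, true))) := by
    intro i j; simp [ce, pe]
  have e3 : ∀ i j : Fin k, ¬ (ce k (Sum.inr i) < ce k (Sum.inl j) ∧
      ¬ (pe k (i, true) < pe k (j, false))) := by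
    intro i j; simp [ce, pe, Fin.lt_def]; omega
  have e4 : ∀ i j : Fin k, (ce k (Sum.inl i) < ce k (Sum.inr j) ∧
      ¬ (pe k (i, false) < pe k (j, true))) ↔ j < i := by
    intro i j; simp only [ce, pe, Equiv.coe_fn_mk, Sum.elim_inl, Sum.elim_inr, Fin.lt_def, if_true, Bool.false_eq_true, if_false]; omega
  simp only [e1, e2, e3, e4, if_false, prod_const_one, one_mul, mul_one]
  have h2 : ∀ i : Fin k, (∏ j : Fin k, if j < i then (-1 : ℤˣ) else 1) = (-1) ^ (i : ℕ) := by
    intro i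
    rw [← prod_filter, prod_const]
    congr 1
    have : univ.filter (fun j => j < i) = Iio i := by ext; simp
    rw [this, Fin.card_Iio]
  simp_rw [h2]
  rw [prod_pow_eq_pow_sum]
  congr 1
  rw [Fin.sum_univ_eq_sum_range (fun i => i), sum_range_id, Nat.choose_two_right]

theorem sum_eq_det (A B : Matrix (Fin (2*k)) (Fin n) R) (f g : Fin k → Fin n) :
    ∑ σ : Perm (Fin (2*k)), ((Perm.sign σ : ℤ) : R) *
        ∏ i, (A (σ (pe k (i, false))) (f i) * B (σ (pe k (i, true))) (g i)) =
      (-1) ^ (k.choose 2) * (concatCB A B f g).det := by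
  have h : (-1 : R) ^ (k.choose 2) = ((Perm.sign (shuf k)⁻¹ : ℤ) : R) := by
    rw [Perm.sign_inv, sign_shuf]; push_cast; rfl
  rw [h, ← Matrix.det_permute', Matrix.det_apply']
  refine sum_congr rfl fun σ _ => ?_
  congr 1
  have hs0 : ∀ i, (shuf k)⁻¹ (pe k (i, false)) = ce k (Sum.inl i) := by
    intro i; rw [← shuf_inl]; simp
  have hs1 : ∀ i, (shuf k)⁻¹ (pe k (i, true)) = ce k (Sum.inr i) := by
    intro i; rw [← shuf_inr]; simp
  rw [← Equiv.prod_comp (pe k), Fintype.prod_prod_type]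
  refine prod_congr rfl fun i _ => ?_
  simp only [Fintype.prod_bool, Matrix.submatrix_apply, id, hs0, hs1, concat_inl, concat_inr]
  ring

theorem fact_main (A B : Matrix (Fin (2*k)) (Fin n) R) (X : Matrix (Fin n) (Fin n) R) :
    (k.factorial : R) * pfaffian (A * X * Bᵀ - B * Xᵀ * Aᵀ) =
      (k.factorial : R) * ((-1 : R)^(Nat.choose k 2) * fAB A B X) := by
  have hZ : B * Xᵀ * Aᵀ = (A * X * Bᵀ)ᵀ := by
    simp [Matrix.transpose_mul, Matrix.mul_assoc]
  rw [hZ, fact_mul_pfaffian, mul_left_comm, ← sum_fg, mul_sum]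
  have h1 : ∀ r s, (A * X * Bᵀ) r s = ∑ a, ∑ b, X a b * (A r a * B s b) := by
    intro r s
    simp only [Matrix.mul_apply, Matrix.transpose_apply, sum_mul]
    rw [sum_comm]
    refine sum_congr rfl fun a _ => sum_congr rfl fun b _ => ?_
    ring
  have h2 : ∀ σ : Perm (Fin (2*k)),
      ∏ i, (A * X * Bᵀ) (σ (pe k (i, false))) (σ (pe k (i, true))) =
      ∑ f : Fin k → Fin n, ∑ g : Fin k → Fin n, (∏ i, X (f i) (g i)) *
        ∏ i, (A (σ (pe k (i, false))) (f i) * B (σ (pe k (i, true))) (g i)) := by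
    intro σ
    simp_rw [h1]
    rw [Fintype.prod_sum]
    refine sum_congr rfl fun f _ => ?_
    rw [Fintype.prod_sum]
    refine sum_congr rfl fun g _ => ?_
    rw [prod_mul_distrib]
  simp_rw [h2, mul_sum]
  rw [sum_comm]
  refine sum_congr rfl fun f _ => ?_
  rw [sum_comm]
  refine sum_congr rfl fun g _ => ?_
  rw [mul_left_comm, ← sum_eq_det, mul_sum]
  refine sum_congr rfl fun σ _ => ?_
  ring

variable {S : Type*} [CommRing S]

theorem map_pfaffian (φ : S →+* R) (Y : Matrix (Fin (2*k)) (Fin (2*k)) S) :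
    φ (pfaffian Y) = pfaffian (Y.map φ) := by
  simp [pfaffian, map_sum, map_prod]

theorem map_fAB (φ : S →+* R) (A B : Matrix (Fin (2*k)) (Fin n) S)
    (X : Matrix (Fin n) (Fin n) S) :
    φ (fAB A B X) = fAB (A.map φ) (B.map φ) (X.map φ) := by
  simp only [fAB, map_sum, map_mul, RingHom.map_det]
  refine sum_congr rfl fun f _ => sum_congr rfl fun g _ => ?_
  congr 2
  ext i j
  simp only [concatCB, RingHom.mapMatrix_apply, Matrix.map_apply, Matrix.of_apply]
  split_ifs <;> rfl

end

end PfAux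

/-- Theorem (Pfaffian expansion, second main theorem): for `m = 2k` even,
`Pf(A·X·Bᵗ − B·Xᵗ·Aᵗ) = (−1)^{binom(m/2,2)} · f_{A,B}(X)`. -/
theorem pfaffian_eq_fAB {R : Type*} [CommRing R] (k n : ℕ) (hk : 0 < k) (hn : 0 < n)
    (A B : Matrix (Fin (2*k)) (Fin n) R) (X : Matrix (Fin n) (Fin n) R) :
    pfaffian (A * X * Bᵀ - B * Xᵀ * Aᵀ) = (-1 : R)^(Nat.choose k 2) * fAB A B X := by
  let V := (Fin (2*k) × Fin n) ⊕ ((Fin (2*k) × Fin n) ⊕ (Fin n × Fin n))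
  let φ : MvPolynomial V ℤ →+* R := MvPolynomial.eval₂Hom (Int.castRingHom R)
    (Sum.elim (fun p => A p.1 p.2) (Sum.elim (fun p => B p.1 p.2) (fun p => X p.1 p.2)))
  let A' : Matrix (Fin (2*k)) (Fin n) (MvPolynomial V ℤ) :=
    Matrix.of fun i j => MvPolynomial.X (Sum.inl (i, j))
  let B' : Matrix (Fin (2*k)) (Fin n) (MvPolynomial V ℤ) :=
    Matrix.of fun i j => MvPolynomial.X (Sum.inr (Sum.inl (i, j)))
  let X' : Matrix (Fin n) (Fin n) (MvPolynomial V ℤ) :=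
    Matrix.of fun i j => MvPolynomial.X (Sum.inr (Sum.inr (i, j)))
  have hA : A'.map φ = A := by ext i j; simp [A', φ]
  have hB : B'.map φ = B := by ext i j; simp [B', φ]
  have hX : X'.map φ = X := by ext i j; simp [X', φ]
  have hf : (k.factorial : MvPolynomial V ℤ) ≠ 0 := by
    exact_mod_cast k.factorial_ne_zero
  have key := congrArg φ (mul_left_cancel₀ hf (PfAux.fact_main A' B' X'))
  rw [PfAux.map_pfaffian, map_mul, PfAux.map_fAB, hA, hB, hX] at key
  have hY : (A' * X' * B'ᵀ - B' * X'ᵀ * A'ᵀ).map φ = A * X * Bᵀ - B * Xᵀ * Aᵀ := by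
    rw [Matrix.map_sub _ (fun a b => map_sub φ a b)]
    simp only [Matrix.map_mul, Matrix.transpose_map, hA, hB, hX]
  rw [hY] at key
  simpa using key
end

section
/- Let m and n be positive integers with m even, and let A and B be m×n matrices over a commutative ring. Then Pf(A·Bᵗ − B·Aᵗ) = (−1)^{binom(m/2, 2)} · Σ_{I⊆[n], |I|=m/2} det(Aᴵ Bᴵ). -/
open Matrix

/-- interleaved indexing -/
def pcbE (k : ℕ) : Fin k × Bool ≃ Fin (2*k) where
  toFun p := ⟨2 * (p.1 : ℕ) + p.2.toNat, by
    have := p.1.isLt; have := Bool.toNat_le p.2; omega⟩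
  invFun x := (⟨(x:ℕ)/2, by have := x.isLt; omega⟩, decide ((x:ℕ) % 2 = 1))
  left_inv := by
    rintro ⟨⟨i, hi⟩, b⟩
    cases b <;> simp <;> omega
  right_inv := by
    rintro ⟨x, hx⟩
    by_cases h : x % 2 = 1 <;> simp [h] <;> omega

/-- concatenated indexing -/
def pcbE' (k : ℕ) : Fin k × Bool ≃ Fin (2*k) where
  toFun p := ⟨(p.1 : ℕ) + k * p.2.toNat, by
    have := p.1.isLt; rcases p with ⟨i, _ | _⟩ <;> simp at * <;> omega⟩
  invFun x := (if h : (x:ℕ) < k then ⟨x, h⟩ else ⟨(x:ℕ) - k, by have := x.isLt; omega⟩,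
    decide (k ≤ (x:ℕ)))
  left_inv := by
    rintro ⟨⟨i, hi⟩, b⟩
    cases b <;> simp [hi]
  right_inv := by
    rintro ⟨x, hx⟩
    rcases lt_or_ge x k with h | h
    · simp [h]
    · simp [h, not_lt.2 h]

/-- hyperoctahedral action -/
def pcbH {k : ℕ} (π : Equiv.Perm (Fin k)) (s : Fin k → Bool) : Equiv.Perm (Fin k × Bool) :=
  (Equiv.prodCongrLeft (fun _ : Bool => π)).trans
    (Equiv.prodCongrRight (fun i => if s i then Equiv.swap false true else 1))

lemma pcbH_apply {k : ℕ} (π : Equiv.Perm (Fin k)) (s : Fin k → Bool) (i : Fin k) (b : Bool) :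
    pcbH π s (i, b) = (π i, xor b (s (π i))) := by
  simp only [pcbH, Equiv.trans_apply, Equiv.prodCongrLeft_apply, Equiv.prodCongrRight_apply]
  cases b <;> cases s (π i) <;> simp

lemma pcbH_sign {k : ℕ} (π : Equiv.Perm (Fin k)) (s : Fin k → Bool) :
    Equiv.Perm.sign (pcbH π s) = ∏ i, (if s i then -1 else 1) := by
  rw [pcbH, Equiv.Perm.sign_trans, Equiv.Perm.sign_prodCongrRight, Equiv.Perm.sign_prodCongrLeft]
  simp only [Fintype.prod_bool, Int.units_mul_self, mul_one]
  refine Finset.prod_congr rfl fun i _ => ?_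
  split_ifs <;> simp

/-- sign of shuffle -/
lemma pcb_shuffle (k : ℕ) :
    Equiv.Perm.sign ((pcbE k).symm.trans (pcbE' k)) = (-1) ^ (Nat.choose k 2) := by
  rw [Equiv.Perm.sign_eq_prod_prod_Iio]
  simp only [← Finset.filter_gt_eq_Iio, Finset.prod_filter]
  rw [← (pcbE k).prod_comp]
  simp only [← (pcbE k).prod_comp (fun x => ite (x < _) _ _)]
  simp only [Fintype.prod_prod_type, Fintype.prod_bool, Equiv.trans_apply,
    Equiv.symm_apply_apply]
  trans (∏ b : Fin k, ∏ a : Fin k, if a < b then (-1 : ℤˣ) else 1)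
  · refine Finset.prod_congr rfl fun b _ => ?_
    rw [← Finset.prod_mul_distrib]
    refine Finset.prod_congr rfl fun a _ => ?_
    have ha := a.isLt
    have hb := b.isLt
    simp only [pcbE, pcbE', Equiv.coe_fn_mk, Fin.lt_def, Bool.toNat_true, Bool.toNat_false, mul_one, mul_zero]
    split_ifs <;> first | omega | rfl
  · simp only [← Finset.prod_filter, Finset.prod_const]
    rw [Finset.prod_pow_eq_pow_sum]
    congr 1
    have : ∀ b : Fin k, (Finset.univ.filter (fun a : Fin k => a < b)).card = b := by
      intro b; rw [Finset.filter_gt_eq_Iio, Fin.card_Iio]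
    simp only [this]
    rw [Fin.sum_univ_eq_sum_range (fun i => i), Finset.sum_range_id, Nat.choose_two_right]

/-- interleaved matrix -/
def pcbC {R : Type*} [CommRing R] {k n : ℕ} (A B : Matrix (Fin (2*k)) (Fin n) R)
    (f : Fin k → Fin n) : Matrix (Fin (2*k)) (Fin (2*k)) R :=
  Matrix.of fun x y => if ((pcbE k).symm y).2 then B x (f ((pcbE k).symm y).1)
    else A x (f ((pcbE k).symm y).1)

lemma pcb_concat {R : Type*} [CommRing R] {k n : ℕ} (A B : Matrix (Fin (2*k)) (Fin n) R)
    (f : Fin k → Fin n) :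
    pcbC A B f = (concatCB A B f f).submatrix id ((pcbE k).symm.trans (pcbE' k)) := by
  ext x y
  obtain ⟨⟨i, b⟩, rfl⟩ := (pcbE k).surjective y
  cases b <;> simp [pcbC, concatCB, pcbE']

lemma pcb_detC {R : Type*} [CommRing R] {k n : ℕ} (A B : Matrix (Fin (2*k)) (Fin n) R)
    (f : Fin k → Fin n) :
    (pcbC A B f).det = (-1) ^ (Nat.choose k 2) * (concatCB A B f f).det := by
  rw [pcb_concat, Matrix.det_permute', pcb_shuffle]
  simp

lemma pcb_detC_perm {R : Type*} [CommRing R] {k n : ℕ} (A B : Matrix (Fin (2*k)) (Fin n) R)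
    (f : Fin k → Fin n) (π : Equiv.Perm (Fin k)) :
    (pcbC A B (f ∘ π)).det = (pcbC A B f).det := by
  have : pcbC A B (f ∘ π) = (pcbC A B f).submatrix id
      ((pcbE k).permCongr (pcbH π (fun _ => false))) := by
    ext x y
    obtain ⟨⟨i, b⟩, rfl⟩ := (pcbE k).surjective y
    cases b <;> simp [pcbC, Equiv.permCongr_apply, pcbH_apply]
  rw [this, Matrix.det_permute', Equiv.Perm.sign_permCongr, pcbH_sign]
  simp

lemma pcb_sort {k : ℕ} {α : Type*} [LinearOrder α] (f : Fin k → α) (hf : Function.Injective f) :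
    ∃! π : Equiv.Perm (Fin k), StrictMono (f ∘ π) := by
  refine ⟨Tuple.sort f, (Tuple.monotone_sort f).strictMono_of_injective
    (hf.comp (Equiv.injective _)), fun π hπ => ?_⟩
  have h2 : StrictMono (f ∘ Tuple.sort f) := (Tuple.monotone_sort f).strictMono_of_injective
    (hf.comp (Equiv.injective _))
  have : f ∘ π = f ∘ Tuple.sort f := by
    rw [← StrictMono.range_inj hπ h2]
    simp [Set.range_comp]
  ext i
  exact congrArg _ (hf (congrFun this i))

lemma pcb_sum_f {R : Type*} [CommRing R] {k n : ℕ} (A B : Matrix (Fin (2*k)) (Fin n) R) :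
    ∑ f : Fin k → Fin n, (pcbC A B f).det
      = (k.factorial : R) * ∑ f ∈ incrFuns k n, (pcbC A B f).det := by
  classical
  have h1 : ∀ f : Fin k → Fin n, (pcbC A B f).det =
      ∑ π : Equiv.Perm (Fin k), if StrictMono (f ∘ π) then (pcbC A B (f ∘ π)).det else 0 := by
    intro f
    by_cases hf : Function.Injective f
    · obtain ⟨π, hπ, hu⟩ := pcb_sort f hf
      rw [Finset.sum_eq_single π]
      · rw [if_pos hπ, pcb_detC_perm]
      · intro π' _ hne
        rw [if_neg fun h => hne (hu _ h)]
      · simp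
    · rw [Finset.sum_eq_zero]
      · simp only [Function.Injective, not_forall] at hf
        obtain ⟨a, b, hab, hne⟩ := hf
        refine Matrix.det_zero_of_column_eq (i := pcbE k (a, false)) (j := pcbE k (b, false))
          (by simpa using hne) ?_
        intro x
        simp [pcbC, hab]
      · intro π _
        rw [if_neg]
        intro h
        apply hf
        have := h.injective.comp π.symm.injective
        simpa [Function.comp_assoc] using this
  rw [Finset.sum_congr rfl fun f _ => h1 f, Finset.sum_comm]
  have h2 : ∀ π : Equiv.Perm (Fin k), (∑ f : Fin k → Fin n,
      if StrictMono (f ∘ π) then (pcbC A B (f ∘ π)).det else 0)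
      = ∑ f ∈ incrFuns k n, (pcbC A B f).det := by
    intro π
    rw [incrFuns, Finset.sum_filter]
    exact (Equiv.arrowCongr π.symm (Equiv.refl (Fin n))).sum_comp
      (fun f => if StrictMono f then (pcbC A B f).det else 0)
  simp [h2, Fintype.card_perm]

/-- normal form -/
def pcbN {k : ℕ} (τ : Equiv.Perm (Fin (2*k))) : Prop :=
  (∀ i : Fin k, τ (pcbE k (i, false)) < τ (pcbE k (i, true))) ∧
  (∀ i j : Fin k, i < j → τ (pcbE k (i, false)) < τ (pcbE k (j, false)))

/-- signed term -/
def pcbF {R : Type*} [CommRing R] {k : ℕ} (Y : Matrix (Fin (2*k)) (Fin (2*k)) R)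
    (τ : Equiv.Perm (Fin (2*k))) : R :=
  ((Equiv.Perm.sign τ : ℤ) : R) * ∏ i : Fin k, Y (τ (pcbE k (i, false))) (τ (pcbE k (i, true)))

open Classical in
lemma pcb_pf {R : Type*} [CommRing R] {k : ℕ} (Y : Matrix (Fin (2*k)) (Fin (2*k)) R) :
    pfaffian Y = ∑ τ : Equiv.Perm (Fin (2*k)), if pcbN τ then pcbF Y τ else 0 := by
  rw [← Finset.sum_filter, pfaffian]
  refine Finset.sum_congr ?_ fun _ _ => rfl
  ext τ
  simp only [Finset.mem_filter, Finset.mem_univ, true_and]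
  rfl

/-- action on perms -/
def pcbG {k : ℕ} (p : Equiv.Perm (Fin k) × (Fin k → Bool)) : Equiv.Perm (Fin (2*k)) :=
  (pcbE k).permCongr (pcbH p.1 p.2)

lemma pcbG_apply {k : ℕ} (p : Equiv.Perm (Fin k) × (Fin k → Bool)) (i : Fin k) (b : Bool) :
    pcbG p (pcbE k (i, b)) = pcbE k (p.1 i, xor b (p.2 (p.1 i))) := by
  simp [pcbG, Equiv.permCongr_apply, pcbH_apply]

lemma pcbG_sign {k : ℕ} (p : Equiv.Perm (Fin k) × (Fin k → Bool)) :
    Equiv.Perm.sign (pcbG p) = ∏ i, (if p.2 i then -1 else 1) := by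
  rw [pcbG, Equiv.Perm.sign_permCongr, pcbH_sign]

lemma pcbG_unique {k : ℕ} (τ : Equiv.Perm (Fin (2*k))) : ∃! p, pcbN (τ * pcbG p) := by
  have hN : ∀ p : Equiv.Perm (Fin k) × (Fin k → Bool), pcbN (τ * pcbG p) ↔
      (∀ i, τ (pcbE k (i, p.2 i)) < τ (pcbE k (i, !p.2 i))) ∧
      StrictMono ((fun i => τ (pcbE k (i, p.2 i))) ∘ p.1) := by
    intro p
    simp only [pcbN, Equiv.Perm.mul_apply, pcbG_apply, Bool.false_xor, Bool.true_xor]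
    refine and_congr ?_ Iff.rfl
    exact p.1.forall_congr_right (q := fun i => τ (pcbE k (i, p.2 i)) < τ (pcbE k (i, !p.2 i)))
  have hS : ∀ s : Fin k → Bool, (∀ i, τ (pcbE k (i, s i)) < τ (pcbE k (i, !s i))) ↔
      s = fun i => decide (τ (pcbE k (i, true)) < τ (pcbE k (i, false))) := by
    intro s
    rw [funext_iff]
    refine forall_congr' fun i => ?_
    have hne : τ (pcbE k (i, true)) ≠ τ (pcbE k (i, false)) := by simp
    cases s i
    · simp [hne.symm.le_iff_lt]
    · simp
  set s0 : Fin k → Bool := fun i => decide (τ (pcbE k (i, true)) < τ (pcbE k (i, false)))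
  have hinj : Function.Injective (fun i => τ (pcbE k (i, s0 i))) := by
    intro i j h
    have := (pcbE k).injective (τ.injective h)
    exact (Prod.mk.inj this).1
  obtain ⟨π, hπ, hu⟩ := pcb_sort _ hinj
  refine ⟨(π, s0), (hN _).2 ⟨(hS _).2 rfl, hπ⟩, ?_⟩
  rintro ⟨π', s'⟩ h
  obtain ⟨h1, h2⟩ := (hN _).1 h
  obtain rfl := (hS _).1 h1
  rw [hu π' h2]

lemma pcbF_G {R : Type*} [CommRing R] {k : ℕ} (Y : Matrix (Fin (2*k)) (Fin (2*k)) R)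
    (hY : ∀ x y, Y x y = - Y y x)
    (τ : Equiv.Perm (Fin (2*k))) (p : Equiv.Perm (Fin k) × (Fin k → Bool)) :
    pcbF Y (τ * pcbG p) = pcbF Y τ := by
  simp only [pcbF, Equiv.Perm.mul_apply, pcbG_apply, Bool.false_xor, Bool.true_xor,
    Equiv.Perm.sign_mul, pcbG_sign]
  rw [Equiv.prod_comp p.1 (fun i => Y (τ (pcbE k (i, p.2 i))) (τ (pcbE k (i, !p.2 i))))]
  push_cast
  rw [mul_assoc, ← Finset.prod_mul_distrib]
  congr 1
  refine Finset.prod_congr rfl fun i _ => ?_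
  by_cases hs : p.2 i = true
  · simp [hs, hY (τ (pcbE k (i, true)))]
  · simp [hs]

lemma pcb_pf_all {R : Type*} [CommRing R] {k : ℕ} (Y : Matrix (Fin (2*k)) (Fin (2*k)) R)
    (hY : ∀ x y, Y x y = - Y y x) :
    ∑ τ, pcbF Y τ = (k.factorial * 2 ^ k : R) * pfaffian Y := by
  classical
  have h1 : ∀ τ, pcbF Y τ = ∑ p, if pcbN (τ * pcbG p) then pcbF Y (τ * pcbG p) else 0 := by
    intro τ
    obtain ⟨p, hp, hu⟩ := pcbG_unique τ
    rw [Finset.sum_eq_single p]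
    · rw [if_pos hp, pcbF_G Y hY]
    · intro p' _ hne
      rw [if_neg fun h => hne (hu _ h)]
    · simp
  rw [Finset.sum_congr rfl fun f _ => h1 f, Finset.sum_comm]
  have h2 : ∀ p, (∑ τ, if pcbN (τ * pcbG p) then pcbF Y (τ * pcbG p) else 0) = pfaffian Y := by
    intro p
    rw [pcb_pf]
    exact Equiv.sum_comp (Equiv.mulRight (pcbG p)) (fun τ => if pcbN τ then pcbF Y τ else 0)
  simp [h2, Fintype.card_perm]

lemma pcb_flip {R : Type*} [CommRing R] {k : ℕ} (M : Matrix (Fin (2*k)) (Fin (2*k)) R) :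
    ∑ τ, pcbF (M - Mᵀ) τ = (2 ^ k : R) * ∑ τ, pcbF M τ := by
  have h1 : ∀ τ, pcbF (M - Mᵀ) τ = ∑ s : Fin k → Bool, pcbF M (τ * pcbG (1, s)) := by
    intro τ
    have : ∀ i : Fin k, (M - Mᵀ) (τ (pcbE k (i, false))) (τ (pcbE k (i, true))) =
        ∑ b : Bool, (if b then -1 else 1) * M (τ (pcbE k (i, b))) (τ (pcbE k (i, !b))) := by
      intro i
      simp
      ring
    simp only [pcbF, this, Fintype.prod_sum, Finset.mul_sum]
    refine Finset.sum_congr rfl fun s _ => ?_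
    simp only [Equiv.Perm.mul_apply, pcbG_apply, Bool.false_xor, Bool.true_xor,
      Equiv.Perm.sign_mul, pcbG_sign, Equiv.Perm.one_apply]
    push_cast
    rw [mul_assoc, ← Finset.prod_mul_distrib]
    congr 1
    refine Finset.prod_congr rfl fun i _ => ?_
    by_cases hs : s i = true <;> simp [hs]
  rw [Finset.sum_congr rfl fun f _ => h1 f, Finset.sum_comm]
  have h2 : ∀ s : Fin k → Bool, (∑ τ, pcbF M (τ * pcbG (1, s))) = ∑ τ, pcbF M τ := by
    intro s
    exact Equiv.sum_comp (Equiv.mulRight (pcbG (1, s))) (fun τ => pcbF M τ)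
  simp [h2]

lemma pcb_expand {R : Type*} [CommRing R] {k n : ℕ} (A B : Matrix (Fin (2*k)) (Fin n) R) :
    ∑ τ, pcbF (A * Bᵀ) τ = ∑ f : Fin k → Fin n, (pcbC A B f).det := by
  simp only [pcbF, Matrix.mul_apply, Fintype.prod_sum, Finset.mul_sum, Matrix.det_apply']
  rw [Finset.sum_comm]
  refine Finset.sum_congr rfl fun f _ => Finset.sum_congr rfl fun τ _ => ?_
  congr 1
  rw [← (pcbE k).prod_comp, Fintype.prod_prod_type]
  refine Finset.prod_congr rfl fun i _ => ?_
  simp [pcbC, mul_comm]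

lemma pcb_main {R : Type*} [CommRing R] [IsDomain R] [CharZero R] (k n : ℕ)
    (A B : Matrix (Fin (2*k)) (Fin n) R) :
    pfaffian (A * Bᵀ - B * Aᵀ)
      = (-1 : R)^(Nat.choose k 2) * ∑ fI ∈ incrFuns k n, (concatCB A B fI fI).det := by
  have hT : A * Bᵀ - B * Aᵀ = A * Bᵀ - (A * Bᵀ)ᵀ := by simp
  have h1 := pcb_pf_all (A * Bᵀ - B * Aᵀ) (by
    intro x y
    rw [hT]
    simp only [Matrix.sub_apply, Matrix.transpose_apply]
    ring)
  rw [hT, pcb_flip, pcb_expand, pcb_sum_f, ← hT] at h1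
  simp only [pcb_detC, ← Finset.mul_sum] at h1
  have h0 : (k.factorial * 2 ^ k : R) ≠ 0 :=
    mul_ne_zero (Nat.cast_ne_zero.2 k.factorial_ne_zero) (pow_ne_zero _ two_ne_zero)
  apply mul_left_cancel₀ h0
  rw [← h1]
  ring

lemma pcb_map_pf {R S : Type*} [CommRing R] [CommRing S] (φ : R →+* S) {k : ℕ}
    (Y : Matrix (Fin (2*k)) (Fin (2*k)) R) : φ (pfaffian Y) = pfaffian (Y.map φ) := by
  simp [pfaffian, map_sum, map_prod]

lemma pcb_map_concat {R S : Type*} [CommRing R] [CommRing S] (φ : R →+* S) {k n : ℕ}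
    (A B : Matrix (Fin (2*k)) (Fin n) R) (f : Fin k → Fin n) :
    φ (concatCB A B f f).det = (concatCB (A.map φ) (B.map φ) f f).det := by
  rw [RingHom.map_det]
  congr 1
  ext i j
  by_cases h : (j : ℕ) < k <;> simp [concatCB, h]

/-- Pfaffian analogue of the Cauchy–Binet theorem: for `m = 2k` even,
`Pf(A·Bᵗ − B·Aᵗ) = (−1)^{binom(m/2,2)} · Σ_{I⊆[n], |I|=m/2} det(Aᴵ Bᴵ)`. -/
theorem pfaffian_cauchy_binet {R : Type*} [CommRing R] (k n : ℕ) (hk : 0 < k) (hn : 0 < n)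
    (A B : Matrix (Fin (2*k)) (Fin n) R) :
    pfaffian (A * Bᵀ - B * Aᵀ)
      = (-1 : R)^(Nat.choose k 2) * ∑ fI ∈ incrFuns k n, (concatCB A B fI fI).det := by
  let φ : MvPolynomial (Bool × Fin (2*k) × Fin n) ℤ →+* R :=
    MvPolynomial.eval₂Hom (Int.castRingHom R) (fun p => if p.1 then B p.2.1 p.2.2 else A p.2.1 p.2.2)
  let A0 : Matrix (Fin (2*k)) (Fin n) (MvPolynomial (Bool × Fin (2*k) × Fin n) ℤ) :=
    Matrix.of fun x c => MvPolynomial.X (false, x, c)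
  let B0 : Matrix (Fin (2*k)) (Fin n) (MvPolynomial (Bool × Fin (2*k) × Fin n) ℤ) :=
    Matrix.of fun x c => MvPolynomial.X (true, x, c)
  have hA : A0.map φ = A := by ext x c; simp [A0, φ]
  have hB : B0.map φ = B := by ext x c; simp [B0, φ]
  have h := congrArg φ (pcb_main k n A0 B0)
  rw [pcb_map_pf, map_mul, map_sum, map_pow, map_neg, map_one] at h
  simp only [pcb_map_concat, hA, hB] at h
  rw [← h]
  congr 1
  rw [Matrix.map_sub _ (map_sub φ), Matrix.map_mul, Matrix.map_mul, Matrix.transpose_map, Matrix.transpose_map, hA, hB]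
end

section
/- Let Y be a skew-symmetric m×m matrix over a commutative ring with m even, and let M = (a_i·b_j)_{1≤i,j≤m} be a rank-1 matrix of the same size given by elements a_1,…,a_m, b_1,…,b_m. Then det(Y + M) = Pf(Y) · ( Pf(Y) + Σ_{1≤i<j≤m} (−1)^{i+j−1} (a_i·b_j − a_j·b_i) · Pf(Y(i,j)) ), where Y(i,j) arises from Y by deleting the i-th and j-th rows and columns. -/
open Matrix

/-- The order-preserving embedding `Fin (2k) → Fin (2k+2)` that misses the two
indices `i < j`; used to delete the `i`-th and `j`-th rows and columns. -/
def delTwo {k : ℕ} (i j : Fin (2*(k+1))) (hij : i < j) : Fin (2*k) → Fin (2*(k+1)) :=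
  fun t =>
    Fin.cast (by omega)
      ((Fin.cast (by omega) j : Fin (2*k+1+1)).succAbove
        ((⟨(i:ℕ), by have h1 : (i:ℕ) < (j:ℕ) := hij; have h2 := j.isLt; omega⟩ :
            Fin (2*k+1)).succAbove t))

/-- Prepend the value `j` to a permutation. -/
def pfBump {n : ℕ} (j : Fin (n+1)) (τ : Equiv.Perm (Fin n)) : Equiv.Perm (Fin (n+1)) :=
  j.cycleRange.symm * Equiv.Perm.decomposeFin.symm (0, τ)

lemma pfBump_zero {n : ℕ} (j : Fin (n+1)) (τ : Equiv.Perm (Fin n)) : pfBump j τ 0 = j := by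
  simp [pfBump]

lemma pfBump_succ {n : ℕ} (j : Fin (n+1)) (τ : Equiv.Perm (Fin n)) (i : Fin n) :
    pfBump j τ i.succ = j.succAbove (τ i) := by
  simp [pfBump]

lemma pfBump_sign {n : ℕ} (j : Fin (n+1)) (τ : Equiv.Perm (Fin n)) :
    Equiv.Perm.sign (pfBump j τ) = (-1)^(j:ℕ) * Equiv.Perm.sign τ := by
  simp [pfBump, Fin.sign_cycleRange, Equiv.Perm.decomposeFin.symm_sign]

lemma pfBump_surj {n : ℕ} (σ : Equiv.Perm (Fin (n+1))) : ∃ τ, pfBump (σ 0) τ = σ := by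
  refine ⟨(Equiv.Perm.decomposeFin ((σ 0).cycleRange * σ)).2, ?_⟩
  have h : (Equiv.Perm.decomposeFin ((σ 0).cycleRange * σ)).1 = 0 := by
    have := Equiv.Perm.decomposeFin_symm_apply_zero
      (Equiv.Perm.decomposeFin ((σ 0).cycleRange * σ)).1
      (Equiv.Perm.decomposeFin ((σ 0).cycleRange * σ)).2
    rw [← this]
    simp
  have h' : (0, (Equiv.Perm.decomposeFin ((σ 0).cycleRange * σ)).2)
      = Equiv.Perm.decomposeFin ((σ 0).cycleRange * σ) := Prod.ext h.symm rfl
  unfold pfBump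
  rw [h', Equiv.symm_apply_apply]
  ext x
  simp

lemma pfaffian_zero' {R : Type*} [CommRing R] (Y : Matrix (Fin (2*0)) (Fin (2*0)) R) :
    pfaffian Y = 1 := by
  unfold pfaffian
  have : (Finset.univ : Finset (Equiv.Perm (Fin (2*0)))) = {1} := by
    ext σ
    simp only [Finset.mem_univ, Finset.mem_singleton, true_iff]
    ext x
    exact x.elim0
  rw [this, Finset.filter_singleton, if_pos]
  · simp
  · exact ⟨fun i => i.elim0, fun i => i.elim0⟩

lemma pfaffian_succ' {R : Type*} [CommRing R] {k : ℕ}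
    (Y : Matrix (Fin (2*k+1+1)) (Fin (2*k+1+1)) R) :
    pfaffian (k := k+1) Y = ∑ j : Fin (2*k+1), (-1 : R)^(j:ℕ) * Y 0 j.succ *
      pfaffian (Y.submatrix (fun t => (j.succAbove t).succ) (fun t => (j.succAbove t).succ)) := by
  simp only [pfaffian, Finset.mul_sum]
  rw [Finset.sum_sigma']
  symm
  refine Finset.sum_bij (fun x _ => pfBump 0 (pfBump x.1 x.2)) ?_ ?_ ?_ ?_
  · rintro ⟨j, τ⟩ h
    simp only [Finset.mem_sigma, Finset.mem_univ, true_and, Finset.mem_filter] at h ⊢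
    obtain ⟨h1, h2⟩ := h
    have e0 : pfBump 0 (pfBump j τ) ⟨0, by omega⟩ = 0 := pfBump_zero _ _
    have e1 : pfBump 0 (pfBump j τ) ⟨1, by omega⟩ = j.succ := by
      have := pfBump_succ 0 (pfBump j τ) 0
      rw [pfBump_zero] at this
      simpa using this
    have e2 : ∀ (m : ℕ) (hm : m < 2*k), pfBump 0 (pfBump j τ) ⟨m+2, by omega⟩
        = (j.succAbove (τ ⟨m, hm⟩)).succ := by
      intro m hm
      have := pfBump_succ 0 (pfBump j τ) (Fin.succ ⟨m, hm⟩)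
      rw [Fin.zero_succAbove, pfBump_succ j τ] at this
      exact this
    constructor
    · intro i
      refine Fin.cases ?_ (fun i => ?_) i
      · show pfBump 0 (pfBump j τ) ⟨0, _⟩ < pfBump 0 (pfBump j τ) ⟨1, _⟩
        rw [e0, e1]
        exact Fin.succ_pos j
      · show pfBump 0 (pfBump j τ) ⟨2*i+2, _⟩ < pfBump 0 (pfBump j τ) ⟨2*i+1+2, _⟩
        rw [e2, e2, Fin.succ_lt_succ_iff, (Fin.strictMono_succAbove j).lt_iff_lt]
        exact h1 i
    · intro a b
      refine Fin.cases ?_ (fun a => ?_) a <;> refine Fin.cases ?_ (fun b => ?_) b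
      · intro h
        exact absurd h (lt_irrefl _)
      · intro _
        show pfBump 0 (pfBump j τ) ⟨0, _⟩ < pfBump 0 (pfBump j τ) ⟨2*b+2, _⟩
        rw [e0, e2 _ (by omega)]
        exact Fin.succ_pos _
      · intro h
        exact absurd h (Fin.not_lt_zero _)
      · intro h
        show pfBump 0 (pfBump j τ) ⟨2*a+2, _⟩ < pfBump 0 (pfBump j τ) ⟨2*b+2, _⟩
        rw [e2, e2, Fin.succ_lt_succ_iff, (Fin.strictMono_succAbove j).lt_iff_lt]
        exact h2 a b (Fin.succ_lt_succ_iff.1 h)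
  · rintro ⟨j, τ⟩ _ ⟨j', τ'⟩ _ h
    have hh : pfBump j τ = pfBump j' τ' := by
      ext x
      have := congrArg (fun σ => σ x.succ) h
      simp only [pfBump_succ] at this
      rw [Fin.succAbove_right_injective this]
    have hj : j = j' := by
      have := congrArg (fun σ => σ 0) hh
      simpa only [pfBump_zero] using this
    subst hj
    have : τ = τ' := by
      ext x
      have := congrArg (fun σ => σ x.succ) hh
      simp only [pfBump_succ] at this
      rw [Fin.succAbove_right_injective this]
    rw [this]
  · intro σ h
    simp only [Finset.mem_univ, true_and, Finset.mem_filter] at h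
    obtain ⟨h1, h2⟩ := h
    have hσ0 : σ 0 = 0 := by
      obtain ⟨x, hx⟩ := σ.surjective 0
      by_contra hne
      obtain ⟨i, hi⟩ : ∃ i : ℕ, (x:ℕ) = 2*i ∨ (x:ℕ) = 2*i+1 := ⟨x/2, by omega⟩
      have hik : i < k+1 := by have := x.isLt; omega
      rcases hi with hi | hi
      · rcases Nat.eq_zero_or_pos i with h0 | h0
        · apply hne
          have : x = 0 := Fin.ext (by simp [hi, h0])
          rw [this] at hx; exact hx
        · have := h2 ⟨0, by omega⟩ ⟨i, hik⟩ h0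
          have e : (⟨2*i, by omega⟩ : Fin (2*(k+1))) = x := Fin.ext hi.symm
          simp only [e] at this
          rw [hx] at this
          exact absurd this (Fin.not_lt_zero _)
      · have := h1 ⟨i, hik⟩
        have e : (⟨2*i+1, by omega⟩ : Fin (2*(k+1))) = x := Fin.ext hi.symm
        simp only [e] at this
        rw [hx] at this
        exact absurd this (Fin.not_lt_zero _)
    obtain ⟨ρ, hρ⟩ := pfBump_surj (n := 2*k+1) σ
    obtain ⟨τ, hτ⟩ := pfBump_surj ρ
    rw [hσ0] at hρ
    generalize ρ 0 = j at hτ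
    subst hτ
    subst hρ
    have e2 : ∀ (m : ℕ) (hm : m < 2*k), pfBump 0 (pfBump j τ) ⟨m+2, by omega⟩
        = (j.succAbove (τ ⟨m, hm⟩)).succ := by
      intro m hm
      have := pfBump_succ 0 (pfBump j τ) (Fin.succ ⟨m, hm⟩)
      rw [Fin.zero_succAbove, pfBump_succ j τ] at this
      exact this
    refine ⟨⟨j, τ⟩, ?_, rfl⟩
    simp only [Finset.mem_sigma, Finset.mem_univ, true_and, Finset.mem_filter]
    constructor
    · intro i
      have : pfBump 0 (pfBump j τ) ⟨2*i+2, _⟩ < pfBump 0 (pfBump j τ) ⟨2*i+1+2, _⟩ := h1 i.succ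
      rwa [e2 _ (by omega), e2 _ (by omega), Fin.succ_lt_succ_iff,
        (Fin.strictMono_succAbove j).lt_iff_lt] at this
    · intro a b hab
      have : pfBump 0 (pfBump j τ) ⟨2*a+2, _⟩ < pfBump 0 (pfBump j τ) ⟨2*b+2, _⟩ :=
        h2 a.succ b.succ (Fin.succ_lt_succ_iff.2 hab)
      rwa [e2 _ (by omega), e2 _ (by omega), Fin.succ_lt_succ_iff,
        (Fin.strictMono_succAbove j).lt_iff_lt] at this
  · rintro ⟨j, τ⟩ _
    have e0 : pfBump 0 (pfBump j τ) ⟨0, by omega⟩ = 0 := pfBump_zero _ _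
    have e1 : pfBump 0 (pfBump j τ) ⟨1, by omega⟩ = j.succ := by
      have := pfBump_succ 0 (pfBump j τ) 0
      rw [pfBump_zero] at this
      simpa using this
    have e2 : ∀ (m : ℕ) (hm : m < 2*k), pfBump 0 (pfBump j τ) ⟨m+2, by omega⟩
        = (j.succAbove (τ ⟨m, hm⟩)).succ := by
      intro m hm
      have := pfBump_succ 0 (pfBump j τ) (Fin.succ ⟨m, hm⟩)
      rw [Fin.zero_succAbove, pfBump_succ j τ] at this
      exact this
    rw [Fin.prod_univ_succ]
    have hs : Equiv.Perm.sign (pfBump 0 (pfBump j τ)) = (-1)^(j:ℕ) * Equiv.Perm.sign τ := by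
      rw [pfBump_sign, pfBump_sign]; simp
    have hp0 : Y (pfBump 0 (pfBump j τ) ⟨0, by omega⟩) (pfBump 0 (pfBump j τ) ⟨1, by omega⟩)
        = Y 0 j.succ := by rw [e0, e1]
    have hp : ∀ i : Fin k, Y (pfBump 0 (pfBump j τ) ⟨2*i+2, by omega⟩)
        (pfBump 0 (pfBump j τ) ⟨2*i+1+2, by omega⟩)
        = (Y.submatrix (fun t => (j.succAbove t).succ) (fun t => (j.succAbove t).succ))
          (τ ⟨2*i, by omega⟩) (τ ⟨2*i+1, by omega⟩) := by
      intro i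
      rw [e2 _ (by omega), e2 _ (by omega)]; rfl
    have hP := Finset.prod_congr (rfl : (Finset.univ : Finset (Fin k)) = _) (fun i _ => hp i)
    refine Eq.trans ?_ (congrArg₂ (fun (s : ℤˣ) (p : R) => ((s : ℤ) : R) * p) hs.symm
      (congrArg₂ (· * ·) hp0 hP).symm)
    push_cast
    ring

section Wick

variable {R : Type*} [CommRing R] {M : Type*} [AddCommGroup M] [Module R M]

/-- left contraction on the exterior algebra -/
noncomputable def extC (d : Module.Dual R M) : ExteriorAlgebra R M →ₗ[R] ExteriorAlgebra R M :=
  CliffordAlgebra.contractLeft (Q := (0 : QuadraticForm R M)) d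

lemma extC_ι_mul (d : Module.Dual R M) (a : M) (x : ExteriorAlgebra R M) :
    extC d (ExteriorAlgebra.ι R a * x) = d a • x - ExteriorAlgebra.ι R a * extC d x :=
  CliffordAlgebra.contractLeft_ι_mul d a x

lemma extC_one (d : Module.Dual R M) : extC d (1 : ExteriorAlgebra R M) = 0 :=
  CliffordAlgebra.contractLeft_one (Q := (0 : QuadraticForm R M)) d

lemma extC_comm (d d' : Module.Dual R M) (x : ExteriorAlgebra R M) :
    extC d (extC d' x) = - extC d' (extC d x) :=
  CliffordAlgebra.contractLeft_comm (Q := (0 : QuadraticForm R M)) d d' x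

lemma extC_ιMulti (d : Module.Dual R M) : ∀ {n : ℕ} (v : Fin (n+1) → M),
    extC d (ExteriorAlgebra.ιMulti R (n+1) v) =
      ∑ j : Fin (n+1), ((-1 : R)^(j:ℕ) * d (v j)) •
        ExteriorAlgebra.ιMulti R n (fun t => v (j.succAbove t))
  | 0, v => by
    rw [ExteriorAlgebra.ιMulti_succ_apply, extC_ι_mul]
    simp [ExteriorAlgebra.ιMulti_zero_apply, extC_one]
  | n+1, v => by
    rw [ExteriorAlgebra.ιMulti_succ_apply, extC_ι_mul, extC_ιMulti d (Matrix.vecTail v),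
      Fin.sum_univ_succ (n := n+1), Finset.mul_sum, sub_eq_add_neg, ← Finset.sum_neg_distrib]
    congr 1
    · simp [Matrix.vecTail, Function.comp_def]
    · refine Finset.sum_congr rfl fun j _ => ?_
      rw [ExteriorAlgebra.ιMulti_succ_apply (fun t => v (j.succ.succAbove t))]
      simp [Matrix.vecTail, Function.comp_def, pow_succ]

/-- The Wick functional of an alternating form. -/
noncomputable def wick (B : LinearMap.BilinForm R M) (hB : ∀ x, B x x = 0) :
    ExteriorAlgebra R M →ₗ[R] R :=
  (ExteriorAlgebra.algebraMapInv (R := R) (M := M)).toLinearMap ∘ₗ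
    CliffordAlgebra.changeForm (Q := (0 : QuadraticForm R M)) (Q' := (0 : QuadraticForm R M))
      (B := -B) (by ext x; simp [hB])

lemma wick_one (B : LinearMap.BilinForm R M) (hB : ∀ x, B x x = 0) : wick B hB 1 = 1 := by
  unfold wick
  rw [LinearMap.comp_apply]
  erw [CliffordAlgebra.changeForm_one]
  simp

lemma wick_ι_mul (B : LinearMap.BilinForm R M) (hB : ∀ x, B x x = 0) (a : M)
    (x : ExteriorAlgebra R M) :
    wick B hB (ExteriorAlgebra.ι R a * x) = wick B hB (extC (B a) x) := by
  unfold wick extC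
  rw [LinearMap.comp_apply, LinearMap.comp_apply]
  erw [CliffordAlgebra.changeForm_ι_mul, CliffordAlgebra.changeForm_contractLeft]
  rw [LinearMap.neg_apply, map_neg, LinearMap.neg_apply, sub_neg_eq_add]
  have h0 : (ExteriorAlgebra.algebraMapInv (R := R) (M := M)) (ExteriorAlgebra.ι R a) = 0 := by
    simp [ExteriorAlgebra.algebraMapInv]
  generalize CliffordAlgebra.changeForm (Q := (0 : QuadraticForm R M))
    (Q' := (0 : QuadraticForm R M)) _ x = y
  change ExteriorAlgebra.algebraMapInv (R := R) (M := M) (ExteriorAlgebra.ι R a * (y : ExteriorAlgebra R M) + extC (B a) y) = ExteriorAlgebra.algebraMapInv (R := R) (M := M) (extC (B a) y)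
  rw [map_add, map_mul, h0, zero_mul, zero_add]

lemma wick_ιMulti (B : LinearMap.BilinForm R M) (hB : ∀ x, B x x = 0) :
    ∀ {k : ℕ} (v : Fin (2*k) → M), wick B hB (ExteriorAlgebra.ιMulti R (2*k) v)
      = pfaffian (Matrix.of fun i j => B (v i) (v j))
  | 0, v => by
    rw [pfaffian_zero']
    have : ExteriorAlgebra.ιMulti R (2*0) v = 1 := ExteriorAlgebra.ιMulti_zero_apply v
    rw [this, wick_one]
  | k+1, v => by
    rw [pfaffian_succ']
    have : ExteriorAlgebra.ιMulti R (2*(k+1)) v = _ :=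
      ExteriorAlgebra.ιMulti_succ_apply (n := 2*k+1) v
    rw [this, wick_ι_mul, extC_ιMulti, map_sum]
    refine Finset.sum_congr rfl fun j _ => ?_
    rw [map_smul, wick_ιMulti B hB, smul_eq_mul]
    rfl

lemma ι_mul_ιMulti_of_span {n : ℕ} (v : Fin n → M) (c : Fin n → R) :
    ExteriorAlgebra.ι R (∑ i, c i • v i) * ExteriorAlgebra.ιMulti R n v = 0 := by
  rw [map_sum, Finset.sum_mul]
  refine Finset.sum_eq_zero fun i _ => ?_
  rw [map_smul, smul_mul_assoc, ExteriorAlgebra.ιMulti_apply, ExteriorAlgebra.ι_mul_prod_list,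
    smul_zero]

lemma wick_key (B : LinearMap.BilinForm R M) (hB : ∀ x, B x x = 0) {n : ℕ} (v : Fin n → M)
    (c : Fin n → R) (d : Module.Dual R M) :
    wick B hB (extC d (extC (B (∑ i, c i • v i)) (ExteriorAlgebra.ιMulti R n v)))
      = - (d (∑ i, c i • v i) * wick B hB (ExteriorAlgebra.ιMulti R n v)) := by
  have h := extC_ι_mul d (∑ i, c i • v i) (ExteriorAlgebra.ιMulti R n v)
  rw [ι_mul_ιMulti_of_span, map_zero] at h
  rw [extC_comm, map_neg, ← wick_ι_mul, ← sub_eq_zero.1 h.symm, map_smul, smul_eq_mul]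

lemma extC_congr {n : ℕ} (v : Fin n → M) (d d' : Module.Dual R M) (h : ∀ i, d (v i) = d' (v i)) :
    extC d (ExteriorAlgebra.ιMulti R n v) = extC d' (ExteriorAlgebra.ιMulti R n v) := by
  cases n with
  | zero => rw [ExteriorAlgebra.ιMulti_zero_apply, extC_one, extC_one]
  | succ n => simp only [extC_ιMulti, h]

end Wick

/-- alternating matrices -/
def PfAlt {R : Type*} [CommRing R] {n : ℕ} (Y : Matrix (Fin n) (Fin n) R) : Prop :=
  (∀ i j, Y j i = - Y i j) ∧ ∀ i, Y i i = 0

section Gen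

variable {R : Type*} [CommRing R] {n : ℕ}

lemma PfAlt.map {S : Type*} [CommRing S] {Y : Matrix (Fin n) (Fin n) R} (h : PfAlt Y)
    (f : R →+* S) : PfAlt (Y.map f) :=
  ⟨fun i j => by simp [h.1 i j], fun i => by simp [h.2 i]⟩

lemma PfAlt.add_smul {Y Z : Matrix (Fin n) (Fin n) R} (h : PfAlt Y) (h' : PfAlt Z) (c : R) :
    PfAlt (Y + c • Z) :=
  ⟨fun i j => by simp [h.1 i j, h'.1 i j]; ring, fun i => by simp [h.2 i, h'.2 i]⟩

lemma PfAlt.submatrix {m : ℕ} {Y : Matrix (Fin n) (Fin n) R} (h : PfAlt Y) (f : Fin m → Fin n) :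
    PfAlt (Y.submatrix f f) :=
  ⟨fun i j => h.1 _ _, fun i => h.2 _⟩

lemma PfAlt.form {Y : Matrix (Fin n) (Fin n) R} (h : PfAlt Y) (x : Fin n → R) :
    Matrix.toBilin' Y x x = 0 := by
  rw [Matrix.toBilin'_apply]
  rw [← Finset.sum_product', Finset.univ_product_univ]
  refine Finset.sum_involution (fun p _ => p.swap) ?_ ?_ ?_ ?_
  · rintro ⟨i, j⟩ _
    simp only [Prod.swap, h.1 i j]
    ring
  · rintro ⟨i, j⟩ _ hne heq
    simp only [Prod.swap, Prod.mk.injEq] at heq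
    apply hne
    simp [heq.1, h.2]
  · simp
  · simp

lemma pfaffian_map {S : Type*} [CommRing S] {k : ℕ} (Y : Matrix (Fin (2*k)) (Fin (2*k)) R)
    (f : R →+* S) : pfaffian (Y.map f) = f (pfaffian Y) := by
  simp [pfaffian, map_sum, map_prod]

open Polynomial in
lemma exists_generic (R : Type*) [CommRing R] (k : ℕ) :
    ∃ J : Matrix (Fin (2*k)) (Fin (2*k)) R, PfAlt J ∧
      ∀ D : Matrix (Fin (2*k)) (Fin (2*k)) R,
        (D.map (C : R →+* R[X]) + (X : R[X]) • J.map (C : R →+* R[X])).det ∈ nonZeroDivisors R[X] := by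
  let e : Fin (2*k) ≃ Fin k ⊕ Fin k := (finCongr (two_mul k)).trans finSumFinEquiv.symm
  have hJ : ∀ i j, Matrix.J (Fin k) R j i = - Matrix.J (Fin k) R i j := by
    intro i j
    have := congrFun (congrFun (Matrix.J_transpose (Fin k) R) i) j
    simpa using this
  refine ⟨(Matrix.J (Fin k) R).submatrix e e, ⟨fun i j => hJ _ _, fun i => ?_⟩, fun D => ?_⟩
  · simp only [Matrix.submatrix_apply]
    generalize e i = x
    rcases x with x | x <;> simp [Matrix.J]
  · set J := (Matrix.J (Fin k) R).submatrix e e with hJd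
    have hu : IsUnit J.det := by
      rw [hJd, Matrix.det_submatrix_equiv_self]
      exact Matrix.isUnit_det_J _ _
    have h1 : J * J⁻¹ = 1 := Matrix.mul_nonsing_inv _ hu
    have h2 : (D.map (C : R →+* R[X]) + (X : R[X]) • J.map (C : R →+* R[X])) *
        (J⁻¹).map (C : R →+* R[X]) = Matrix.charmatrix (-(D * J⁻¹)) := by
      rw [add_mul, Matrix.smul_mul, ← Matrix.map_mul, ← Matrix.map_mul, h1, Matrix.charmatrix]
      generalize D * J⁻¹ = N
      ext1 i j
      simp [Matrix.map_apply, Matrix.one_apply, Matrix.scalar_apply, Matrix.diagonal_apply, apply_ite]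
      split_ifs <;> ring
    have h3 := congrArg Matrix.det h2
    rw [Matrix.det_mul] at h3
    have h4 : (Matrix.charmatrix (-(D * J⁻¹))).det ∈ nonZeroDivisors R[X] :=
      (Matrix.charpoly_monic _).mem_nonZeroDivisors
    rw [← h3] at h4
    exact (mul_mem_nonZeroDivisors.1 h4).1

end Gen

section Schur

variable {R : Type*} [CommRing R]

lemma PfAlt.inv_form {n : ℕ} {D : Matrix (Fin n) (Fin n) R} (_h : PfAlt D) (hu : IsUnit D.det)
    (a b : Fin n → R) : (a ᵥ* D⁻¹) ⬝ᵥ b = Matrix.toBilin' D (b ᵥ* D⁻¹) (a ᵥ* D⁻¹) := by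
  rw [Matrix.toBilin'_apply', Matrix.dotProduct_mulVec, Matrix.vecMul_vecMul,
    Matrix.nonsing_inv_mul _ hu, Matrix.vecMul_one, dotProduct_comm]

lemma PfAlt.inv_self {n : ℕ} {D : Matrix (Fin n) (Fin n) R} (h : PfAlt D) (hu : IsUnit D.det)
    (a : Fin n → R) : (a ᵥ* D⁻¹) ⬝ᵥ a = 0 := by
  rw [h.inv_form hu, h.form]

lemma PfAlt.inv_swap {n : ℕ} {D : Matrix (Fin n) (Fin n) R} (h : PfAlt D) (hu : IsUnit D.det)
    (a b : Fin n → R) : (b ᵥ* D⁻¹) ⬝ᵥ a = - ((a ᵥ* D⁻¹) ⬝ᵥ b) := by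
  rw [h.inv_form hu, h.inv_form hu]
  have : (Matrix.toBilin' D).IsAlt := fun x => h.form x
  rw [LinearMap.IsAlt.neg this]

lemma toBilin_sum {n m : ℕ} (Z : Matrix (Fin n) (Fin n) R) (f : Fin m → Fin n) (c : Fin m → R)
    (j : Fin n) :
    Matrix.toBilin' Z (∑ i, c i • Pi.single (f i) 1) (Pi.single j 1) = ∑ i, c i * Z (f i) j := by
  rw [map_sum, LinearMap.sum_apply]
  refine Finset.sum_congr rfl fun i _ => ?_
  rw [map_smul, LinearMap.smul_apply, Matrix.toBilin'_single, smul_eq_mul]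

lemma toBilin_sum' {n m : ℕ} (Z : Matrix (Fin n) (Fin n) R) (f : Fin m → Fin n) (c : Fin m → R)
    (j : Fin n) :
    Matrix.toBilin' Z (Pi.single j 1) (∑ i, c i • Pi.single (f i) 1) = ∑ i, c i * Z j (f i) := by
  rw [map_sum]
  refine Finset.sum_congr rfl fun i _ => ?_
  rw [map_smul, Matrix.toBilin'_single, smul_eq_mul]

lemma schur_pf {k : ℕ} (Z : Matrix (Fin (2*k+1+1)) (Fin (2*k+1+1)) R) (hZ : PfAlt Z)
    (D : Matrix (Fin (2*k)) (Fin (2*k)) R)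
    (hD : D = Z.submatrix (fun i => i.succ.succ) (fun i => i.succ.succ)) (hu : IsUnit D.det) :
    pfaffian (k := k+1) Z = pfaffian D *
      (Z 0 1 + ((fun i => Z 0 i.succ.succ) ᵥ* D⁻¹) ⬝ᵥ (fun i => Z 1 i.succ.succ)) := by
  set B := Matrix.toBilin' Z with hBdef
  have hB : ∀ x, B x x = 0 := hZ.form
  let w : Fin (2*k+1+1) → (Fin (2*k+1+1) → R) := fun i => Pi.single i 1
  let v : Fin (2*k) → (Fin (2*k+1+1) → R) := fun i => Pi.single i.succ.succ 1
  have h1 : wick B hB (ExteriorAlgebra.ιMulti R (2*(k+1)) w) = pfaffian (k := k+1) Z := by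
    rw [wick_ιMulti]
    congr 1
    ext i j
    exact Matrix.toBilin'_single Z i j
  have h2 : wick B hB (ExteriorAlgebra.ιMulti R (2*k) v) = pfaffian D := by
    rw [wick_ιMulti, hD]
    congr 1
    ext i j
    exact Matrix.toBilin'_single Z _ _
  have h3 : ExteriorAlgebra.ιMulti R (2*(k+1)) w = ExteriorAlgebra.ι R (w 0) *
      (ExteriorAlgebra.ι R (w 1) * ExteriorAlgebra.ιMulti R (2*k) v) := by
    have e1 : ExteriorAlgebra.ιMulti R (2*(k+1)) w = _ :=
      ExteriorAlgebra.ιMulti_succ_apply (n := 2*k+1) w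
    rw [e1, ExteriorAlgebra.ιMulti_succ_apply]
    rfl
  set c := (fun i : Fin (2*k) => Z 0 i.succ.succ) ᵥ* D⁻¹ with hc
  have hcD : c ᵥ* D = fun i : Fin (2*k) => Z 0 i.succ.succ := by
    rw [hc, Matrix.vecMul_vecMul, Matrix.nonsing_inv_mul _ hu, Matrix.vecMul_one]
  have h4 : extC (B (w 0)) (ExteriorAlgebra.ιMulti R (2*k) v) =
      extC (B (∑ i, c i • v i)) (ExteriorAlgebra.ιMulti R (2*k) v) := by
    apply extC_congr
    intro j
    rw [hBdef, toBilin_sum, Matrix.toBilin'_single, ← congrFun hcD j, hD]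
    rfl
  rw [← h1, h3, wick_ι_mul, extC_ι_mul, map_sub, map_smul, wick_ι_mul, h4, wick_key, h2,
    hBdef, toBilin_sum', Matrix.toBilin'_single, smul_eq_mul]
  simp only [dotProduct]
  ring

lemma schur_det {k : ℕ} (Z : Matrix (Fin (2*k+1+1)) (Fin (2*k+1+1)) R) (hZ : PfAlt Z)
    (D : Matrix (Fin (2*k)) (Fin (2*k)) R)
    (hD : D = Z.submatrix (fun i => i.succ.succ) (fun i => i.succ.succ)) (hu : IsUnit D.det) :
    Z.det = D.det *
      (Z 0 1 + ((fun i => Z 0 i.succ.succ) ᵥ* D⁻¹) ⬝ᵥ (fun i => Z 1 i.succ.succ))^2 := by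
  let e : Fin 2 ⊕ Fin (2*k) ≃ Fin (2*k+1+1) := finSumFinEquiv.trans (finCongr (by omega))
  have he0 : e (Sum.inl 0) = 0 := by ext; simp [e]
  have he1 : e (Sum.inl 1) = 1 := by ext; simp [e]
  have her : ∀ i, e (Sum.inr i) = i.succ.succ := by intro i; ext; simp [e]
  have hDa : PfAlt D := hD ▸ hZ.submatrix _
  rw [← Matrix.det_submatrix_equiv_self e, ← Matrix.fromBlocks_toBlocks (Z.submatrix e e)]
  have h22 : (Z.submatrix e e).toBlocks₂₂ = D := by
    ext i j
    simp [Matrix.toBlocks₂₂, her, hD]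
  rw [h22]
  have : Invertible D := Matrix.invertibleOfIsUnitDet D hu
  rw [Matrix.det_fromBlocks₂₂, Matrix.invOf_eq_nonsing_inv]
  congr 1
  have hent : ∀ p q : Fin 2, ((Z.submatrix e e).toBlocks₁₁ -
      (Z.submatrix e e).toBlocks₁₂ * D⁻¹ * (Z.submatrix e e).toBlocks₂₁) p q =
      Z (e (Sum.inl p)) (e (Sum.inl q)) + ((fun i => Z (e (Sum.inl p)) i.succ.succ) ᵥ* D⁻¹) ⬝ᵥ
        (fun i => Z (e (Sum.inl q)) i.succ.succ) := by
    intro p q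
    rw [Matrix.sub_apply, Matrix.mul_apply, sub_eq_add_neg, ← Finset.sum_neg_distrib]
    congr 1
    refine Finset.sum_congr rfl fun i _ => ?_
    have h1 : (Z.submatrix e e).toBlocks₂₁ i q = - Z (e (Sum.inl q)) i.succ.succ := by
      rw [← hZ.1, ← her]; rfl
    have h2 : ((Z.submatrix e e).toBlocks₁₂ * D⁻¹) p i =
        ((fun i => Z (e (Sum.inl p)) i.succ.succ) ᵥ* D⁻¹) i := by
      rw [Matrix.mul_apply]
      refine Finset.sum_congr rfl fun l _ => ?_
      simp only [← her]
      rfl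
    rw [h1, h2, mul_neg, neg_neg]
  rw [Matrix.det_fin_two, hent, hent, hent, hent, he0, he1, hDa.inv_self hu, hDa.inv_self hu,
    hDa.inv_swap hu (fun i => Z 0 i.succ.succ) (fun i => Z 1 i.succ.succ), hZ.2, hZ.2, hZ.1 0 1]
  ring

end Schur

open Polynomial in
theorem det_eq_pf_sq.{u} : ∀ (k : ℕ) {R : Type u} [CommRing R] (Y : Matrix (Fin (2*k)) (Fin (2*k)) R),
    PfAlt Y → Y.det = pfaffian Y ^ 2
  | 0, R, _, Y, _ => by
    rw [pfaffian_zero', one_pow]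
    exact Matrix.det_isEmpty (n := Fin 0)
  | k+1, R, _, Y, hY => by
    obtain ⟨J, hJ, hJD⟩ := exists_generic R k
    let J' : Matrix (Fin (2*k+1+1)) (Fin (2*k+1+1)) R := Matrix.of fun i j =>
      Fin.cases 0 (fun i => Fin.cases 0 (fun i => Fin.cases 0 (fun j => Fin.cases 0
        (fun j => J i j) j) j) i) i
    have hJ' : PfAlt J' := by
      constructor
      · intro i j
        refine Fin.cases ?_ (fun i => ?_) i <;> try refine Fin.cases ?_ (fun i => ?_) i
        all_goals refine Fin.cases ?_ (fun j => ?_) j <;> try refine Fin.cases ?_ (fun j => ?_) j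
        all_goals first | exact hJ.1 _ _ | exact neg_zero.symm
      · intro i
        refine Fin.cases ?_ (fun i => ?_) i <;> try refine Fin.cases ?_ (fun i => ?_) i
        all_goals first | exact hJ.2 _ | rfl
    let Yt : Matrix (Fin (2*k+1+1)) (Fin (2*k+1+1)) R[X] :=
      Matrix.map Y (C : R →+* R[X]) + (X : R[X]) • J'.map (C : R →+* R[X])
    have hYt : PfAlt Yt := PfAlt.add_smul (PfAlt.map hY _) (PfAlt.map hJ' _) _
    have hsub : Yt.submatrix (fun i : Fin (2*k) => i.succ.succ) (fun i => i.succ.succ) =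
        (Matrix.submatrix Y (fun i : Fin (2*k) => i.succ.succ) (fun i => i.succ.succ)).map
          (C : R →+* R[X]) + (X : R[X]) • J.map (C : R →+* R[X]) := by
      ext1 i j
      rfl
    have hev : Yt.map (Polynomial.evalRingHom (0:R)) = Y := by
      ext i j
      simp [Yt]
    have hinj : Function.Injective (algebraMap R[X] (FractionRing R[X])) :=
      IsFractionRing.injective _ _
    have key : Yt.det = pfaffian (k := k+1) Yt ^ 2 := by
      apply hinj
      rw [map_pow, ← pfaffian_map, RingHom.map_det, RingHom.mapMatrix_apply]
      set Z : Matrix (Fin (2*k+1+1)) (Fin (2*k+1+1)) (FractionRing R[X]) :=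
        Yt.map (algebraMap R[X] (FractionRing R[X])) with hZd
      have hZ : PfAlt Z := hYt.map _
      have hu : IsUnit (Z.submatrix (fun i : Fin (2*k) => i.succ.succ)
          (fun i => i.succ.succ)).det := by
        rw [hZd, Matrix.submatrix_map, hsub, ← RingHom.mapMatrix_apply, ← RingHom.map_det]
        exact IsLocalization.map_units (FractionRing R[X])
          (⟨_, hJD _⟩ : nonZeroDivisors R[X])
      rw [schur_det Z hZ _ rfl hu, schur_pf Z hZ _ rfl hu, det_eq_pf_sq k _ (hZ.submatrix _)]
      ring
    have h := congrArg (Polynomial.evalRingHom (0:R)) key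
    rw [map_pow, ← pfaffian_map, RingHom.map_det, RingHom.mapMatrix_apply] at h
    have h' : (Yt.map (Polynomial.evalRingHom (0:R))).det =
      pfaffian (k := k+1) (Yt.map (Polynomial.evalRingHom (0:R))) ^ 2 := h
    rw [hev] at h'
    exact h'

/-- the sum in the theorem -/
def pfSum {R : Type*} [CommRing R] {k : ℕ} (Y : Matrix (Fin (2*(k+1))) (Fin (2*(k+1))) R)
    (a b : Fin (2*(k+1)) → R) : R :=
  ∑ i : Fin (2*(k+1)), ∑ j : Fin (2*(k+1)),
          if hij : i < j then
            (-1 : R)^((i:ℕ) + (j:ℕ) + 1) * (a i * b j - a j * b i) *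
              pfaffian (Y.submatrix (delTwo i j hij) (delTwo i j hij))
          else 0

lemma pfSum_map {R S : Type*} [CommRing R] [CommRing S] {k : ℕ}
    (Y : Matrix (Fin (2*(k+1))) (Fin (2*(k+1))) R)
    (a b : Fin (2*(k+1)) → R) (f : R →+* S) :
    pfSum (Y.map f) (fun i => f (a i)) (fun i => f (b i)) = f (pfSum Y a b) := by
  unfold pfSum
  rw [map_sum]
  refine Finset.sum_congr rfl fun i _ => ?_
  rw [map_sum]
  refine Finset.sum_congr rfl fun j _ => ?_
  split_ifs with h
  · rw [Matrix.submatrix_map, pfaffian_map]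
    simp
  · simp

lemma delTwo_val {k : ℕ} (i j : Fin (2*(k+1))) (hij : i < j) (t : Fin (2*k)) :
    (delTwo i j hij t : ℕ) = if (t:ℕ) < i then (t:ℕ) else if (t:ℕ)+1 < j then t+1 else t+2 := by
  have : (i:ℕ) < j := hij
  simp only [delTwo, Fin.succAbove, Fin.lt_def, Fin.val_cast, Fin.val_castSucc]
  split_ifs <;> simp_all <;> omega

lemma pfSum_eq {R : Type*} [CommRing R] {k : ℕ} (Y : Matrix (Fin (2*(k+1))) (Fin (2*(k+1))) R)
    (a b : Fin (2*k+1+1) → R) :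
    pfSum Y a b = ∑ p : Fin (2*k+1+1), ∑ q : Fin (2*k+1),
      (-1 : R)^(p:ℕ) * a p * ((-1 : R)^(q:ℕ) * b (p.succAbove q) *
        pfaffian (Y.submatrix (fun t => p.succAbove (q.succAbove t))
          (fun t => p.succAbove (q.succAbove t)))) := by
  let F : Fin (2*k+1+1) → Fin (2*k+1+1) → R := fun i j =>
    if hij : i < j then (-1 : R)^((i:ℕ) + (j:ℕ) + 1) *
      pfaffian (Y.submatrix (delTwo (k := k) i j hij) (delTwo (k := k) i j hij)) else 0
  have h1 : pfSum Y a b = ∑ i : Fin (2*k+1+1), ∑ j : Fin (2*k+1+1),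
      (F i j - F j i) * (a i * b j) := by
    have : ∀ i j, (F i j - F j i) * (a i * b j) = F i j * (a i * b j) - F j i * (a i * b j) :=
      fun i j => sub_mul _ _ _
    simp only [this, Finset.sum_sub_distrib]
    rw [Finset.sum_comm (f := fun i j => F j i * (a i * b j)), ← Finset.sum_sub_distrib]
    refine Finset.sum_congr rfl fun i _ => ?_
    rw [← Finset.sum_sub_distrib]
    refine Finset.sum_congr rfl fun j _ => ?_
    by_cases h : i < j
    · simp only [F]
      rw [dif_pos h, dif_pos h]
      ring
    · simp only [F]
      rw [dif_neg h, dif_neg h]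
      ring
  rw [h1]
  refine Finset.sum_congr rfl fun p _ => ?_
  rw [Fin.sum_univ_succAbove _ p, sub_self, zero_mul, zero_add]
  refine Finset.sum_congr rfl fun q _ => ?_
  rcases lt_or_ge (q : ℕ) (p : ℕ) with h | h
  · have hv : (p.succAbove q : ℕ) = q := by
      simp [Fin.succAbove, Fin.lt_def, h]
    have hlt : p.succAbove q < p := by rw [Fin.lt_def, hv]; exact h
    have hd : delTwo (k := k) (p.succAbove q) p hlt =
        fun t => p.succAbove (q.succAbove t) := by
      funext t
      apply Fin.ext
      rw [delTwo_val, hv]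
      simp only [Fin.succAbove, Fin.lt_def, Fin.val_castSucc]
      split_ifs <;> simp_all <;> omega
    simp only [F]
    rw [dif_neg (not_lt.2 hlt.le), dif_pos hlt, hd, hv, pow_succ, pow_add]
    ring
  · have hv : (p.succAbove q : ℕ) = q + 1 := by
      simp [Fin.succAbove, Fin.lt_def, not_lt.2 h]
    have hlt : p < p.succAbove q := by rw [Fin.lt_def, hv]; omega
    have hd : delTwo (k := k) p (p.succAbove q) hlt =
        fun t => p.succAbove (q.succAbove t) := by
      funext t
      apply Fin.ext
      rw [delTwo_val, hv]
      simp only [Fin.succAbove, Fin.lt_def, Fin.val_castSucc]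
      split_ifs <;> simp_all <;> omega
    simp only [F]
    rw [dif_neg (not_lt.2 hlt.le), dif_pos hlt, hd, hv, pow_succ, pow_add, pow_succ]
    ring

lemma pfSum_unit {R : Type*} [CommRing R] {k : ℕ} (Y : Matrix (Fin (2*(k+1))) (Fin (2*(k+1))) R)
    (hY : PfAlt Y) (hu : IsUnit Y.det) (a b : Fin (2*(k+1)) → R) :
    pfSum Y a b = - (((a ᵥ* Y⁻¹) ⬝ᵥ b) * pfaffian Y) := by
  set B := Matrix.toBilin' Y with hBdef
  have hB : ∀ x, B x x = 0 := hY.form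
  let w : Fin (2*(k+1)) → (Fin (2*(k+1)) → R) := fun i => Pi.single i 1
  have h1 : wick B hB (ExteriorAlgebra.ιMulti R (2*(k+1)) w) = pfaffian (k := k+1) Y := by
    rw [wick_ιMulti]
    congr 1
    ext i j
    exact Matrix.toBilin'_single Y i j
  let d : (Fin (2*(k+1)) → R) → Module.Dual R (Fin (2*(k+1)) → R) := fun a =>
    Fintype.linearCombination R a
  have hd : ∀ a i, d a (w i) = a i := by
    intro a i
    simp [d, w, Fintype.linearCombination_apply, Pi.single_apply]
  set c := a ᵥ* Y⁻¹ with hc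
  have hcD : c ᵥ* Y = a := by
    rw [hc, Matrix.vecMul_vecMul, Matrix.nonsing_inv_mul _ hu, Matrix.vecMul_one]
  have h4 : extC (d a) (ExteriorAlgebra.ιMulti R (2*(k+1)) w) =
      extC (B (∑ i, c i • w i)) (ExteriorAlgebra.ιMulti R (2*(k+1)) w) := by
    apply extC_congr
    intro j
    rw [hd, hBdef]
    exact (congrFun hcD j).symm.trans (toBilin_sum Y id c j).symm
  have h5 := wick_key B hB w c (d b)
  rw [← h4, h1] at h5
  have h6 : d b (∑ i, c i • w i) = c ⬝ᵥ b := by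
    rw [map_sum]
    refine Finset.sum_congr rfl fun i _ => ?_
    rw [map_smul, hd, smul_eq_mul]
  rw [h6] at h5
  rw [← h5, pfSum_eq]
  have h7 : extC (d a) (ExteriorAlgebra.ιMulti R (2*(k+1)) w) = _ :=
    extC_ιMulti (n := 2*k+1) (d a) w
  rw [h7, map_sum, map_sum]
  refine Finset.sum_congr rfl fun p _ => ?_
  rw [map_smul, map_smul, extC_ιMulti, map_sum, smul_eq_mul, Finset.mul_sum]
  refine Finset.sum_congr rfl fun q _ => ?_
  rw [map_smul, wick_ιMulti, hd, hd, smul_eq_mul]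
  congr 3
  ext i j
  exact (Matrix.toBilin'_single Y _ _).symm

lemma main_unit {R : Type*} [CommRing R] {k : ℕ} (Y : Matrix (Fin (2*(k+1))) (Fin (2*(k+1))) R)
    (hY : PfAlt Y) (hu : IsUnit Y.det) (a b : Fin (2*(k+1)) → R) :
    (Y + Matrix.of fun i j => a i * b j).det = pfaffian Y * (pfaffian Y + pfSum Y a b) := by
  have h0 : (Matrix.of fun i j => a i * b j) =
      Matrix.replicateCol Unit a * Matrix.replicateRow Unit b := by
    ext i j
    simp [Matrix.mul_apply]
  rw [h0, Matrix.det_add_replicateCol_mul_replicateRow hu, pfSum_unit Y hY hu,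
    det_eq_pf_sq _ Y hY, Matrix.det_unique]
  have h1 : (Matrix.replicateRow Unit b * Y⁻¹ * Matrix.replicateCol Unit a) default default
      = (b ᵥ* Y⁻¹) ⬝ᵥ a := by
    rw [Matrix.mul_apply]
    rfl
  rw [Matrix.add_apply, h1, Matrix.one_apply_eq, ← neg_mul, ← hY.inv_swap hu]
  ring

/-- Proposition: for a skew-symmetric matrix `Y` of even size `m` and a rank-1 matrix
`M = (a_i b_j)`, `det(Y+M) = Pf(Y)·(Pf(Y) + Σ_{i<j} (−1)^{i+j−1}(a_i b_j − a_j b_i) Pf(Y(i,j)))`.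
(In 0-based indexing the sign `(−1)^{i+j−1}` of the 1-based statement becomes
`(−1)^{i+j+1}`.) -/
theorem det_skew_add_rank_one_even {R : Type*} [CommRing R] (k : ℕ)
    (Y : Matrix (Fin (2*(k+1))) (Fin (2*(k+1))) R)
    (hY : Yᵀ = -Y) (hdiag : ∀ i, Y i i = 0) (a b : Fin (2*(k+1)) → R) :
    (Y + Matrix.of fun i j => a i * b j).det
      = pfaffian Y *
        (pfaffian Y + ∑ i : Fin (2*(k+1)), ∑ j : Fin (2*(k+1)),
          if hij : i < j then
            (-1 : R)^((i:ℕ) + (j:ℕ) + 1) * (a i * b j - a j * b i) *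
              pfaffian (Y.submatrix (delTwo i j hij) (delTwo i j hij))
          else 0) := by
  have hYa : PfAlt Y := ⟨fun i j => by simpa using congrFun (congrFun hY i) j, hdiag⟩
  obtain ⟨J, hJ, hJD⟩ := exists_generic R (k+1)
  let Yt : Matrix (Fin (2*(k+1))) (Fin (2*(k+1))) (Polynomial R) :=
    Y.map (Polynomial.C : R →+* Polynomial R) + (Polynomial.X : Polynomial R) • J.map (Polynomial.C : R →+* Polynomial R)
  have hYt : PfAlt Yt := PfAlt.add_smul (hYa.map _) (hJ.map _) _
  have hev : Yt.map (Polynomial.evalRingHom (0:R)) = Y := by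
    ext i j
    simp [Yt]
  have hinj : Function.Injective (algebraMap (Polynomial R) (FractionRing (Polynomial R))) :=
    IsFractionRing.injective _ _
  have hmap : ∀ {A B : Type _} [CommRing A] [CommRing B] (f : A →+* B)
      (Z : Matrix (Fin (2*(k+1))) (Fin (2*(k+1))) A) (u v : Fin (2*(k+1)) → A),
      f (Z + Matrix.of fun i j => u i * v j).det =
        (Z.map f + Matrix.of fun i j => f (u i) * f (v j)).det := by
    intro A B _ _ f Z u v
    rw [RingHom.map_det, RingHom.mapMatrix_apply]
    congr 1
    ext i j
    simp
  have key : (Yt + Matrix.of fun i j => Polynomial.C (a i) * Polynomial.C (b j)).det = pfaffian Yt *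
      (pfaffian Yt + pfSum Yt (fun i => Polynomial.C (a i)) (fun i => Polynomial.C (b i))) := by
    apply hinj
    rw [hmap, map_mul, map_add, ← pfaffian_map, ← pfSum_map]
    apply main_unit _ (hYt.map _)
    rw [← RingHom.mapMatrix_apply, ← RingHom.map_det]
    exact IsLocalization.map_units (FractionRing (Polynomial R)) (⟨_, hJD _⟩ : nonZeroDivisors (Polynomial R))
  have h := congrArg (Polynomial.evalRingHom (0:R)) key
  rw [hmap, map_mul, map_add, ← pfaffian_map, ← pfSum_map, hev] at h
  change _ = pfaffian Y * (pfaffian Y + pfSum Y a b)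
  simpa using h
end

section
/- Let Y be a skew-symmetric m×m matrix over a commutative ring with m odd, and let M = (a_i·b_j)_{1≤i,j≤m} be a rank-1 matrix of the same size given by elements a_1,…,a_m, b_1,…,b_m. Then det(Y + M) = ( Σ_{i=1}^m (−1)^{i−1} a_i · Pf(Y(i)) ) · ( Σ_{j=1}^m (−1)^{j−1} b_j · Pf(Y(j)) ), where Y(i) arises from Y by deleting the i-th row and column. -/
open Matrix

section helpers

/-- normal form -/
def PfNorm (k : ℕ) (σ : Equiv.Perm (Fin (2*k))) : Prop :=
  (∀ i : Fin k,
        σ ⟨2*(i:ℕ), by have := i.isLt; omega⟩ < σ ⟨2*(i:ℕ)+1, by have := i.isLt; omega⟩) ∧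
      (∀ i j : Fin k, i < j →
        σ ⟨2*(i:ℕ), by have := i.isLt; omega⟩ < σ ⟨2*(j:ℕ), by have := j.isLt; omega⟩)

/-- extension -/
def pfExt {n : ℕ} (j : Fin (n+1)) (τ : Equiv.Perm (Fin n)) : Equiv.Perm (Fin (n+1+1)) :=
  Equiv.Perm.decomposeFin.symm (0, (j.cycleRange)⁻¹ * Equiv.Perm.decomposeFin.symm (0, τ))

lemma pfExt_zero {n : ℕ} (j : Fin (n+1)) (τ : Equiv.Perm (Fin n)) : pfExt j τ 0 = 0 := by
  simp [pfExt]

lemma pfExt_one {n : ℕ} (j : Fin (n+1)) (τ : Equiv.Perm (Fin n)) :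
    pfExt j τ (Fin.succ 0) = j.succ := by
  unfold pfExt
  rw [Equiv.Perm.decomposeFin_symm_apply_succ, Equiv.Perm.mul_apply,
    Equiv.Perm.decomposeFin_symm_apply_zero]
  simp [Equiv.Perm.inv_def]

lemma pfExt_succ {n : ℕ} (j : Fin (n+1)) (τ : Equiv.Perm (Fin n)) (p : Fin n) :
    pfExt j τ p.succ.succ = (j.succAbove (τ p)).succ := by
  unfold pfExt
  rw [Equiv.Perm.decomposeFin_symm_apply_succ, Equiv.Perm.mul_apply,
    Equiv.Perm.decomposeFin_symm_apply_succ]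
  simp [Equiv.Perm.inv_def]

lemma pfExt_sign {n : ℕ} (j : Fin (n+1)) (τ : Equiv.Perm (Fin n)) :
    Equiv.Perm.sign (pfExt j τ) = (-1)^(j:ℕ) * Equiv.Perm.sign τ := by
  simp [pfExt]

lemma pfExt_surj {n : ℕ} (σ : Equiv.Perm (Fin (n+1+1))) (h : σ 0 = 0) :
    ∃ j τ, pfExt j τ = σ := by
  obtain ⟨⟨p, ρ⟩, hp⟩ := Equiv.Perm.decomposeFin.symm.surjective σ
  have : p = 0 := by rw [← h, ← hp]; simp
  subst this
  obtain ⟨⟨q, τ⟩, hq⟩ := Equiv.Perm.decomposeFin.symm.surjective ((ρ 0).cycleRange * ρ)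
  have : q = 0 := by
    have h1 := congrArg (fun f => f 0) hq
    simpa using h1
  subst this
  exact ⟨ρ 0, τ, by rw [← hp, pfExt, hq]; simp⟩

lemma pfExt_inj {n : ℕ} {j j' : Fin (n+1)} {τ τ' : Equiv.Perm (Fin n)}
    (h : pfExt j τ = pfExt j' τ') : j = j' ∧ τ = τ' := by
  have h1 : j = j' := by
    have := congrArg (fun f => f (Fin.succ 0)) h
    simpa only [pfExt_one, Fin.succ_inj] using this
  subst h1
  refine ⟨rfl, Equiv.ext fun p => ?_⟩
  have := congrArg (fun f => f p.succ.succ) h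
  simpa only [pfExt_succ, Fin.succ_inj, Fin.succAbove_right_inj] using this

lemma pfNorm_zero {k : ℕ} (σ : Equiv.Perm (Fin (2*(k+1)))) (h : PfNorm (k+1) σ) :
    σ (0 : Fin (2*k+1+1)) = (0 : Fin (2*k+1+1)) := by
  obtain ⟨h1, h2⟩ := h
  obtain ⟨p, hp⟩ := σ.surjective (0 : Fin (2*k+1+1))
  have hmin : ∀ x : Fin (2*(k+1)), ¬ x < σ p := by
    intro x hx
    rw [hp] at hx
    exact absurd hx (Fin.not_lt_zero x)
  obtain ⟨p, hpl⟩ := p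
  rcases Nat.even_or_odd' p with ⟨c, rfl | rfl⟩
  · rcases Nat.eq_zero_or_pos c with rfl | hc
    · exact hp
    · exact absurd (h2 ⟨0, by omega⟩ ⟨c, by omega⟩ hc) (hmin _)
  · exact absurd (h1 ⟨c, by omega⟩) (hmin _)

lemma pfExt_even {k : ℕ} (j : Fin (2*k+1)) (τ : Equiv.Perm (Fin (2*k))) (i : ℕ) (hi : i < k)
    (h : 2*(i+1) < 2*(k+1)) :
    pfExt j τ (⟨2*(i+1), h⟩ : Fin (2*k+1+1)) = (j.succAbove (τ ⟨2*i, by omega⟩)).succ :=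
  pfExt_succ j τ ⟨2*i, by omega⟩

lemma pfExt_odd {k : ℕ} (j : Fin (2*k+1)) (τ : Equiv.Perm (Fin (2*k))) (i : ℕ) (hi : i < k)
    (h : 2*(i+1)+1 < 2*(k+1)) :
    pfExt j τ (⟨2*(i+1)+1, h⟩ : Fin (2*k+1+1)) = (j.succAbove (τ ⟨2*i+1, by omega⟩)).succ :=
  pfExt_succ j τ ⟨2*i+1, by omega⟩

lemma pfExt_lt {n : ℕ} (j : Fin (n+1)) (τ : Equiv.Perm (Fin n)) (p q : Fin n) :
    pfExt j τ p.succ.succ < pfExt j τ q.succ.succ ↔ τ p < τ q := by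
  rw [pfExt_succ, pfExt_succ]; simp

lemma pfExt_pos {n : ℕ} (j : Fin (n+1)) (τ : Equiv.Perm (Fin n)) (q : Fin (n+1)) :
    pfExt j τ 0 < pfExt j τ q.succ := by
  rw [pfExt_zero, Fin.pos_iff_ne_zero]
  intro h
  rw [← pfExt_zero j τ] at h
  exact Fin.succ_ne_zero _ ((pfExt j τ).injective h)

lemma pfNorm_ext {k : ℕ} (j : Fin (2*k+1)) (τ : Equiv.Perm (Fin (2*k))) :
    PfNorm (k+1) (pfExt j τ) ↔ PfNorm k τ := by
  constructor
  · rintro ⟨h1, h2⟩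
    constructor
    · intro i
      exact (pfExt_lt j τ ⟨2*i, by omega⟩ ⟨2*i+1, by omega⟩).1 (h1 i.succ)
    · intro i i' hi
      exact (pfExt_lt j τ ⟨2*i, by omega⟩ ⟨2*i', by omega⟩).1
        (h2 i.succ i'.succ (Fin.succ_lt_succ_iff.2 hi))
  · rintro ⟨h1, h2⟩
    constructor
    · intro i
      refine Fin.cases ?_ (fun i => ?_) i
      · exact pfExt_pos j τ 0
      · exact (pfExt_lt j τ ⟨2*i, by omega⟩ ⟨2*i+1, by omega⟩).2 (h1 i)
    · intro i i'
      refine Fin.cases ?_ (fun i' => ?_) i'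
      · intro h; exact absurd h (Fin.not_lt_zero _)
      refine Fin.cases ?_ (fun i => ?_) i
      · intro _
        exact pfExt_pos j τ (Fin.succ ⟨2*i', by omega⟩)
      · intro hi
        exact (pfExt_lt j τ ⟨2*i, by omega⟩ ⟨2*i', by omega⟩).2
          (h2 i i' (Fin.succ_lt_succ_iff.1 hi))

lemma pf_succ {R : Type*} [CommRing R] {k : ℕ} (Y : Matrix (Fin (2*k+1+1)) (Fin (2*k+1+1)) R) :
    pfaffian (k := k+1) Y = ∑ j : Fin (2*k+1), (-1)^(j:ℕ) * Y 0 j.succ *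
      pfaffian (k := k) (Y.submatrix (fun p => (j.succAbove p).succ)
        (fun p => (j.succAbove p).succ)) := by
  unfold pfaffian
  simp_rw [Finset.mul_sum]
  rw [← Finset.sum_product']
  symm
  refine Finset.sum_bij (fun x _ => pfExt x.1 x.2) ?_ ?_ ?_ ?_
  · rintro ⟨j, τ⟩ h
    rw [Finset.mem_product, Finset.mem_filter] at h
    rw [Finset.mem_filter]
    exact ⟨Finset.mem_univ _, (pfNorm_ext j τ).2 h.2.2⟩
  · rintro ⟨j, τ⟩ _ ⟨j', τ'⟩ _ h
    obtain ⟨h1, h2⟩ := pfExt_inj h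
    exact Prod.ext h1 h2
  · intro σ hσ
    rw [Finset.mem_filter] at hσ
    have hn : PfNorm (k+1) σ := hσ.2
    obtain ⟨j, τ, rfl⟩ := pfExt_surj (n := 2*k) σ (pfNorm_zero σ hn)
    refine ⟨(j, τ), ?_, rfl⟩
    rw [Finset.mem_product, Finset.mem_filter]
    exact ⟨Finset.mem_univ _, Finset.mem_univ _, (pfNorm_ext j τ).1 hn⟩
  · rintro ⟨j, τ⟩ _
    rw [Fin.prod_univ_succ]
    have e0 : Y (pfExt j τ ⟨2 * ((0 : Fin (k+1)) : ℕ), by simp⟩)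
        (pfExt j τ ⟨2 * ((0 : Fin (k+1)) : ℕ) + 1, by simp⟩) = Y 0 j.succ :=
      congrArg₂ Y (pfExt_zero j τ) (pfExt_one j τ)
    have e1 : ∀ i : Fin k, Y (pfExt j τ ⟨2 * (i.succ : ℕ), by have := i.isLt; simp; omega⟩)
        (pfExt j τ ⟨2 * (i.succ : ℕ) + 1, by have := i.isLt; simp⟩) =
        Y (j.succAbove (τ ⟨2*(i:ℕ), by omega⟩)).succ (j.succAbove (τ ⟨2*(i:ℕ)+1, by omega⟩)).succ :=
      fun i => congrArg₂ Y (pfExt_even j τ i i.2 _) (pfExt_odd j τ i i.2 _)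
    have e2 := pfExt_sign j τ
    dsimp only
    erw [e0, Finset.prod_congr rfl (fun i _ => e1 i), e2]
    simp only [Matrix.submatrix_apply]
    push_cast
    ring

lemma pf_map {R S : Type*} [CommRing R] [CommRing S] (f : R →+* S) {k : ℕ}
    (Y : Matrix (Fin (2*k)) (Fin (2*k)) R) : pfaffian (Y.map f) = f (pfaffian Y) := by
  simp [pfaffian, map_sum, map_mul, map_prod]

lemma pf_zero {R : Type*} [CommRing R] (Y : Matrix (Fin (2*0)) (Fin (2*0)) R) :
    pfaffian (k := 0) Y = 1 := by
  have : ∀ σ : Equiv.Perm (Fin (2*0)), σ = 1 := fun σ => Equiv.ext fun x => x.elim0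
  unfold pfaffian
  rw [Finset.filter_true_of_mem, Finset.sum_eq_single 1]
  · simp
  · intro b _ hb; exact absurd (this b) hb
  · simp
  · intro σ _; exact ⟨fun i => i.elim0, fun i => i.elim0⟩

/-- bordered determinant -/
lemma det_border {R : Type*} [CommRing R] {n : ℕ} (M : Matrix (Fin (n+1+1)) (Fin (n+1+1)) R) :
    M.det = M 0 0 * (M.submatrix Fin.succ Fin.succ).det
      - ∑ j : Fin (n+1), ∑ i : Fin (n+1), M 0 j.succ * M i.succ 0 *
        (M.submatrix Fin.succ Fin.succ).adjugate j i := by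
  rw [Matrix.det_succ_row_zero, Fin.sum_univ_succ, sub_eq_add_neg, ← Finset.sum_neg_distrib]
  congr 1
  · simp
  · refine Finset.sum_congr rfl fun j _ => ?_
    rw [Matrix.det_succ_column_zero, Finset.mul_sum, ← Finset.sum_neg_distrib]
    refine Finset.sum_congr rfl fun i _ => ?_
    rw [Matrix.adjugate_fin_succ_eq_det_submatrix]
    have : (M.submatrix Fin.succ j.succ.succAbove).submatrix i.succAbove Fin.succ
      = (M.submatrix Fin.succ Fin.succ).submatrix i.succAbove j.succAbove := by
      ext p q
      simp
    rw [this]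
    simp [pow_succ, pow_add]
    ring

lemma det_rank_one {R : Type*} [CommRing R] {n : ℕ} (Y : Matrix (Fin (n+1)) (Fin (n+1)) R)
    (a b : Fin (n+1) → R) :
    (Y + Matrix.of fun i j => a i * b j).det = Y.det + ∑ j, ∑ i, b j * a i * Y.adjugate j i := by
  let M : Matrix (Fin (n+1+1)) (Fin (n+1+1)) R :=
    Matrix.of (Fin.cons (Fin.cons 1 (fun j => - b j)) (fun i => Fin.cons (a i) (Y i)))
  let N : Matrix (Fin (n+1+1)) (Fin (n+1+1)) R :=
    Matrix.of (Fin.cons (Fin.cons 1 (fun j => - b j))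
      (fun i => Fin.cons 0 (fun j => Y i j + a i * b j)))
  have hMN : M.det = N.det := by
    refine Matrix.det_eq_of_forall_row_eq_smul_add_const (Fin.cons 0 a) 0 rfl ?_
    intro i j
    refine Fin.cases ?_ (fun i => ?_) i
    · simp [M, N]
    · refine Fin.cases ?_ (fun j => ?_) j
      · simp [M, N]
      · simp [M, N]
  have hM := det_border M
  have hN := det_border N
  have sM : M.submatrix Fin.succ Fin.succ = Y := by ext; simp [M]
  have sN : N.submatrix Fin.succ Fin.succ = Y + Matrix.of fun i j => a i * b j := by
    ext; simp [N]
  rw [sM] at hM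
  rw [sN] at hN
  simp [M] at hM
  simp [N] at hN
  rw [← hN]
  change N.det = _
  rw [← hMN]
  exact hM
lemma cramer_ker {R : Type*} [CommRing R] {n : ℕ} (Z : Matrix (Fin n) (Fin n) R) (v : Fin n → R)
    (hv : Z *ᵥ v = 0) (i j l : Fin n) :
    Z.adjugate i j * v l = v i * Z.adjugate l j := by
  set N := Z.updateRow j (Pi.single i 1) with hN
  have h1 : N *ᵥ v = v i • Pi.single j 1 := by
    ext p
    by_cases hp : p = j
    · subst hp
      simp [hN, Matrix.mulVec]
    · have := congrFun hv p
      simpa [hN, Matrix.mulVec, hp, Matrix.updateRow_ne] using this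
  have h2 : N.adjugate *ᵥ (N *ᵥ v) = N.det • v := by
    rw [Matrix.mulVec_mulVec, Matrix.adjugate_mul, Matrix.smul_mulVec, Matrix.one_mulVec]
  rw [h1] at h2
  have h3 := congrFun h2 l
  have h4 : N.adjugate l j = Z.adjugate l j := by
    rw [Matrix.adjugate_apply, Matrix.adjugate_apply, hN, Matrix.updateRow_idem]
  rw [Matrix.mulVec_smul] at h3
  simp [h4] at h3
  rw [Matrix.adjugate_apply, ← hN, ← h3]

/-- alternating -/
def IsAlt {R : Type*} [CommRing R] {n : ℕ} (Y : Matrix (Fin n) (Fin n) R) : Prop :=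
  Yᵀ = -Y ∧ ∀ i, Y i i = 0

lemma IsAlt.sub {R : Type*} [CommRing R] {n m : ℕ} {Y : Matrix (Fin n) (Fin n) R} (h : IsAlt Y)
    (f : Fin m → Fin n) : IsAlt (Y.submatrix f f) := by
  refine ⟨?_, fun i => h.2 _⟩
  rw [Matrix.transpose_submatrix, h.1]; rfl

/-- ones above the diagonal -/
def upOnes (n : ℕ) : Matrix (Fin n) (Fin n) ℤ :=
  Matrix.of fun i j => if i < j then 1 else if j < i then -1 else 0

lemma upOnes_alt (n : ℕ) : IsAlt (upOnes n) := by
  constructor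
  · ext i j
    simp only [upOnes, Matrix.transpose_apply, Matrix.of_apply, Matrix.neg_apply]
    split_ifs <;> first | omega | simp
  · intro i; simp [upOnes]

lemma upOnes_sub {n m : ℕ} (f : Fin m → Fin n) (hf : StrictMono f) :
    (upOnes n).submatrix f f = upOnes m := by
  ext i j
  simp [upOnes, hf.lt_iff_lt]

lemma alt_sum (k : ℕ) : ∑ j : Fin (2*k+1), (-1 : ℤ)^(j:ℕ) = 1 := by
  rw [Fin.sum_univ_eq_sum_range (fun j => (-1 : ℤ)^j)]
  induction k with
  | zero => simp
  | succ k ih =>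
    rw [show 2*(k+1)+1 = 2*k+1+1+1 by ring, Finset.sum_range_succ, Finset.sum_range_succ, ih]
    simp [pow_succ, pow_mul]

lemma pf_upOnes (k : ℕ) : pfaffian (upOnes (2*k)) = 1 := by
  induction k with
  | zero => exact pf_zero _
  | succ k ih =>
    refine (pf_succ (k := k) (upOnes (2*k+1+1))).trans ?_
    refine Eq.trans ?_ (alt_sum k)
    refine Finset.sum_congr rfl fun j _ => ?_
    rw [upOnes_sub, ih]
    · simp [upOnes]
    · intro p q hpq
      simpa using hpq

lemma upOnes_ker (k : ℕ) :
    upOnes (2*k+1) *ᵥ (fun j => (-1 : ℤ)^(j:ℕ)) = 0 := by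
  have key : ∀ n m : ℕ, m ≤ n → 
     ∑ j ∈ Finset.range n, (if m < j then (1:ℤ) else if j < m then -1 else 0) * (-1)^j
      = (∑ j ∈ Finset.range n, (-1 : ℤ)^j) - (if Even m then 0 else 2) - (if m < n then (-1)^m else 0) := by
    intro n
    induction n with
    | zero => 
      intro m hm
      obtain rfl : m = 0 := by omega
      simp
    | succ n ih =>
      intro m hm
      rw [Finset.sum_range_succ, Finset.sum_range_succ]
      rcases Nat.lt_or_ge n m with h | h
      · obtain rfl : m = n + 1 := by omega
        have h0 : ∑ j ∈ Finset.range n, (if n + 1 < j then (1:ℤ) else if j < n + 1 then -1 else 0)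
            * (-1)^j = - ∑ j ∈ Finset.range n, (-1 : ℤ)^j := by
          rw [← Finset.sum_neg_distrib]
          refine Finset.sum_congr rfl fun j hj => ?_
          have := Finset.mem_range.1 hj
          rw [if_neg (by omega), if_pos (by omega)]; ring
        rw [h0, if_neg (by omega), if_pos (by omega), if_neg (lt_irrefl _), neg_one_geom_sum]
        rcases Nat.even_or_odd n with he | ho
        · rw [if_pos he, if_neg (by simpa [Nat.even_add_one] using he), he.neg_one_pow]; norm_num
        · have : ¬ Even n := by simpa using ho
          rw [if_neg this, if_pos (by simpa [Nat.even_add_one] using ho), ho.neg_one_pow]; norm_num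
      · rw [ih m h]
        rcases Nat.eq_or_lt_of_le h with rfl | h'
        · rw [if_neg (lt_irrefl _), if_neg (lt_irrefl _), if_neg (lt_irrefl _), if_pos (Nat.lt_succ_self _)]; ring
        · rw [if_pos h', if_pos h', if_pos (show m < n + 1 by omega)]; ring
  ext i
  have hs := alt_sum k
  rw [Fin.sum_univ_eq_sum_range (fun j => (-1 : ℤ)^j)] at hs
  have := key (2*k+1) i i.2.le
  rw [hs, if_pos i.2] at this
  have h2 : (upOnes (2*k+1) *ᵥ (fun j => (-1 : ℤ)^(j:ℕ))) i = 
      ∑ j ∈ Finset.range (2*k+1), (if (i:ℕ) < j then (1:ℤ) else if j < i then -1 else 0) * (-1)^j := by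
    rw [← Fin.sum_univ_eq_sum_range 
      (fun j => (if (i:ℕ) < j then (1:ℤ) else if j < i then -1 else 0) * (-1)^j)]
    rfl
  rw [h2, this]
  rcases Nat.even_or_odd (i:ℕ) with he | ho
  · rw [if_pos he, he.neg_one_pow]; rfl
  · rw [if_neg (by simpa using ho), ho.neg_one_pow]; rfl

/-- generic alternating matrix -/
noncomputable def genAlt (n : ℕ) : Matrix (Fin n) (Fin n) (MvPolynomial (Fin n × Fin n) ℤ) :=
  Matrix.of fun i j => if i < j then MvPolynomial.X (i, j)
    else if j < i then - MvPolynomial.X (j, i) else 0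

lemma genAlt_alt (n : ℕ) : IsAlt (genAlt n) := by
  constructor
  · ext1 i j
    simp only [genAlt, Matrix.transpose_apply, Matrix.of_apply, Matrix.neg_apply]
    split_ifs <;> first | omega | simp
  · intro i; simp [genAlt]

lemma genAlt_map {R : Type*} [CommRing R] {n : ℕ} {Y : Matrix (Fin n) (Fin n) R} (h : IsAlt Y) :
    ∃ f : MvPolynomial (Fin n × Fin n) ℤ →+* R, (genAlt n).map f = Y := by
  refine ⟨MvPolynomial.eval₂Hom (Int.castRingHom R) (fun p => Y p.1 p.2), ?_⟩
  ext i j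
  rcases lt_trichotomy i j with hij | rfl | hij
  · simp [genAlt, hij]
  · simp [genAlt, h.2]
  · have := congrFun (congrFun h.1 i) j
    simp only [Matrix.transpose_apply, Matrix.neg_apply] at this
    simp [genAlt, hij, hij.not_gt, this]

/-- signed sub-Pfaffian -/
def pfv {R : Type*} [CommRing R] {k : ℕ} (Y : Matrix (Fin (2*k+1)) (Fin (2*k+1)) R)
    (i : Fin (2*k+1)) : R := (-1)^(i:ℕ) * pfaffian (Y.submatrix i.succAbove i.succAbove)

lemma pfv_map {R S : Type*} [CommRing R] [CommRing S] (f : R →+* S) {k : ℕ}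
    (Y : Matrix (Fin (2*k+1)) (Fin (2*k+1)) R) (i : Fin (2*k+1)) :
    pfv (Y.map f) i = f (pfv Y i) := by
  simp only [pfv, map_mul, map_pow, map_neg, map_one, ← pf_map, Matrix.submatrix_map]

lemma odd_of_even (k : ℕ)
    (E : ∀ (S : Type) [CommRing S] (Y : Matrix (Fin (2*k)) (Fin (2*k)) S), IsAlt Y →
      Y.det = pfaffian Y ^ 2)
    {R : Type*} [CommRing R] (Y : Matrix (Fin (2*k+1)) (Fin (2*k+1)) R) (hY : IsAlt Y) :
    Y.det = 0 ∧ ∀ i j, Y.adjugate i j = pfv Y i * pfv Y j := by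
  have diag : ∀ (S : Type) [CommRing S] (Z : Matrix (Fin (2*k+1)) (Fin (2*k+1)) S), IsAlt Z →
      ∀ i, Z.adjugate i i = pfv Z i ^ 2 := by
    intro S _ Z hZ i
    rw [Matrix.adjugate_fin_succ_eq_det_submatrix, E _ _ (hZ.sub _), pfv]
    ring
  obtain ⟨f, hf⟩ := genAlt_map hY
  set G := genAlt (2*k+1) with hG
  have hGa : IsAlt G := genAlt_alt _
  have hdet : G.det = 0 := by
    have h1 : G.det = - G.det := by
      conv_lhs => rw [← Matrix.det_transpose, hGa.1, Matrix.det_neg]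
      simp [pow_succ, pow_mul]
    exact self_eq_neg.1 h1
  have hsymm : ∀ i j, G.adjugate i j = G.adjugate j i := by
    intro i j
    have h1 := Matrix.adjugate_transpose G
    rw [hGa.1, ← neg_one_smul (MvPolynomial (Fin (2*k+1) × Fin (2*k+1)) ℤ) G,
      Matrix.adjugate_smul] at h1
    have h2 := congrFun (congrFun h1 j) i
    simpa [pow_mul] using h2
  have hsq : ∀ i j, G.adjugate i j ^ 2 = (pfv G i * pfv G j) ^ 2 := by
    intro i j
    have hker : G *ᵥ (fun l => G.adjugate l i) = 0 := by
      have := Matrix.mul_adjugate G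
      rw [hdet, zero_smul] at this
      ext1 p
      exact congrFun (congrFun this p) i
    have h1 := cramer_ker G _ hker i j j
    rw [hsymm j i, diag _ G hGa, diag _ G hGa] at h1
    rw [sq, h1]; ring
  obtain ⟨g, hg⟩ := genAlt_map (upOnes_alt (2*k+1))
  have hone : ∀ i, pfv (upOnes (2*k+1)) i = (-1)^(i:ℕ) := by
    intro i
    rw [pfv, upOnes_sub _ (Fin.strictMono_succAbove i), pf_upOnes, mul_one]
  have hupadj : ∀ i j, (upOnes (2*k+1)).adjugate i j = (-1)^(i:ℕ) * (-1)^(j:ℕ) := by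
    intro i j
    have h1 := cramer_ker _ _ (upOnes_ker k) i j j
    rw [diag _ _ (upOnes_alt _), hone, ← pow_mul, mul_comm (j:ℕ) 2, pow_mul] at h1
    have h3 : ((-1 : ℤ)^(j:ℕ)) * (-1)^(j:ℕ) = 1 := by
      rw [← mul_pow]; simp
    simp only [neg_one_sq, one_pow, mul_one] at h1
    rw [← h1, mul_assoc, h3, mul_one]
  have hadj : ∀ i j, G.adjugate i j = pfv G i * pfv G j := by
    intro i j
    rcases sq_eq_sq_iff_eq_or_eq_neg.1 (hsq i j) with h | h
    · exact h
    · exfalso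
      have h1 := congrArg g h
      rw [map_neg, map_mul, ← pfv_map, ← pfv_map, hg, hone, hone] at h1
      have h2 : g (G.adjugate i j) = (upOnes (2*k+1)).adjugate i j := by
        rw [← hg]
        exact congrFun (congrFun (RingHom.map_adjugate g G) i) j
      rw [h2, hupadj] at h1
      have h3 := self_eq_neg.1 h1
      simp at h3
  constructor
  · rw [← hf]
    have := RingHom.map_det f G
    rw [hdet, map_zero] at this
    exact this.symm
  · intro i j
    rw [← hf, pfv_map, pfv_map, ← map_mul, ← hadj]
    exact (congrFun (congrFun (RingHom.map_adjugate f G) i) j).symm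

lemma det_even (k : ℕ) : ∀ (S : Type) [CommRing S] (Y : Matrix (Fin (2*k)) (Fin (2*k)) S),
    IsAlt Y → Y.det = pfaffian Y ^ 2 := by
  induction k with
  | zero =>
    intro S _ Y _
    rw [pf_zero, one_pow]
    exact Matrix.det_fin_zero
  | succ k ih =>
    intro S _ Y hY
    change Matrix (Fin (2*k+1+1)) (Fin (2*k+1+1)) S at Y
    have hO := (odd_of_even k ih (Y.submatrix Fin.succ Fin.succ) (hY.sub _)).2
    have h1 := pf_succ Y
    refine (det_border Y).trans ?_
    refine Eq.trans ?_ (congrArg (· ^ 2) h1).symm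
    rw [hY.2 0, zero_mul, zero_sub, sq, Finset.sum_mul_sum, ← Finset.sum_neg_distrib]
    refine Finset.sum_congr rfl fun j _ => ?_
    rw [← Finset.sum_neg_distrib]
    refine Finset.sum_congr rfl fun i _ => ?_
    have h2 : Y i.succ 0 = - Y 0 i.succ := congrFun (congrFun hY.1 0) i.succ
    rw [hO, h2, pfv, pfv, Matrix.submatrix_submatrix, Matrix.submatrix_submatrix]
    simp only [Function.comp_def]
    ring

end helpers

/-- Proposition: for a skew-symmetric matrix `Y` of odd size `m = 2k+1` and a rank-1
matrix `M = (a_i b_j)`,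
`det(Y+M) = (Σ_i (−1)^{i−1} a_i Pf(Y(i))) · (Σ_j (−1)^{j−1} b_j Pf(Y(j)))`,
where `Y(i)` arises from `Y` by deleting the `i`-th row and column.
(In 0-based indexing the sign `(−1)^{i−1}` of the 1-based statement becomes `(−1)^i`.) -/
theorem det_skew_add_rank_one_odd {R : Type*} [CommRing R] (k : ℕ)
    (Y : Matrix (Fin (2*k+1)) (Fin (2*k+1)) R)
    (hY : Yᵀ = -Y) (hdiag : ∀ i, Y i i = 0) (a b : Fin (2*k+1) → R) :
    (Y + Matrix.of fun i j => a i * b j).det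
      = (∑ i : Fin (2*k+1),
            (-1 : R)^(i:ℕ) * a i * pfaffian (Y.submatrix i.succAbove i.succAbove)) *
        (∑ j : Fin (2*k+1),
            (-1 : R)^(j:ℕ) * b j * pfaffian (Y.submatrix j.succAbove j.succAbove)) := by
  obtain ⟨h1, h2⟩ := odd_of_even k (det_even k) Y ⟨hY, hdiag⟩
  rw [det_rank_one, h1, zero_add]
  refine Eq.trans ?_ (mul_comm _ _)
  rw [Finset.sum_mul_sum]
  refine Finset.sum_congr rfl fun j _ => Finset.sum_congr rfl fun i _ => ?_
  rw [h2, pfv, pfv]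
  ring
end
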